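/- arXiv:0811.4217 — 11 statements merged into one kernel-verified Lean document; each statement's English description precedes it below -/
import Mathlib

section
/- Let Ω ⊆ ℝⁿ be an open set and let f : Ω → ℝⁿ be continuous and satisfy the three-point condition with constants C ≥ 1 and K ≥ 1 on Ω. Suppose that for every continuously differentiable curve γ : [a,b] → Ω the composition f ∘ γ has finite total variation on [a,b]. Let a₀ ∈ Ω with f(a₀) ≠ 0, and let x, y : (−ε₀, ε₀) → Ω be differentiable with x′(t) = f(x(t)), y′(t) = f(y(t)) for all t, and x(0) = y(0) = a₀. Then there exists ε > 0 such that x(t) = y(t) for all |t| < ε. -/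
open Set Filter Topology in
/-- The `L¹` modulus of continuity of a function of bounded variation is controlled by its
variation. -/
theorem integral_norm_sub_translate_le {E : Type*} [NormedAddCommGroup E] {g : ℝ → E}
    {η T D : ℝ} (hg : ContinuousOn g (Icc 0 η)) (hBV : LocallyBoundedVariationOn g (Icc 0 η))
    (hT : 0 ≤ T) (hD : 0 < D) (hTD : T + D ≤ η) :
    ∫ t in (0 : ℝ)..T, ‖g (t + D) - g t‖ ≤ D * variationOnFromTo g (Icc 0 η) 0 (T + D) := by
  set V := variationOnFromTo g (Icc 0 η) 0 with hV
  have h0 : (0 : ℝ) ∈ Icc 0 η := ⟨le_rfl, by linarith⟩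
  have hmono : MonotoneOn V (Icc 0 (T + D)) :=
    (variationOnFromTo.monotoneOn hBV h0).mono (Icc_subset_Icc_right hTD)
  have hle : ∀ t ∈ Icc 0 T, ‖g (t + D) - g t‖ ≤ D * slope V t (t + D) := by
    intro t ht
    have h1 : t ∈ Icc 0 η := ⟨ht.1, by linarith [ht.2]⟩
    have h2 : t + D ∈ Icc 0 η := ⟨by linarith [ht.1], by linarith [ht.2]⟩
    have h3 : D * slope V t (t + D) = variationOnFromTo g (Icc 0 η) t (t + D) := by
      rw [← variationOnFromTo.sub_right hBV h0 h2 h1, ← hV, slope_def_field, add_sub_cancel_left,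
        mul_div_cancel₀ _ hD.ne']
    rw [h3, variationOnFromTo.eq_of_le _ _ (by linarith), ← dist_eq_norm, dist_edist]
    refine ENNReal.toReal_mono (hBV t (t + D) h1 h2) (eVariationOn.edist_le g ?_ ?_)
    exacts [⟨h2, by linarith, le_rfl⟩, ⟨h1, le_rfl, by linarith⟩]
  have hnormInt : IntervalIntegrable (fun t ↦ ‖g (t + D) - g t‖) MeasureTheory.volume 0 T := by
    apply ContinuousOn.intervalIntegrable_of_Icc hT
    refine ((hg.comp (by fun_prop) fun t ht ↦ ?_).sub (hg.mono ?_)).norm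
    · exact ⟨by linarith [ht.1], by linarith [ht.2]⟩
    · exact Icc_subset_Icc_right (by linarith)
  calc ∫ t in (0 : ℝ)..T, ‖g (t + D) - g t‖
      ≤ ∫ t in (0 : ℝ)..T, D * slope V t (t + D) :=
        intervalIntegral.integral_mono_on hT hnormInt
          ((hmono.intervalIntegrable_slope hT hD.le).const_mul D) hle
    _ ≤ D * (V (T + D) - V 0) := by
        rw [intervalIntegral.integral_const_mul]
        exact mul_le_mul_of_nonneg_left (hmono.intervalIntegral_slope_le hT hD.le) hD.le
    _ = D * V (T + D) := by rw [hV, variationOnFromTo.self, sub_zero]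

open Set Filter Topology in
/-- Forward uniqueness: two solutions issued from a non-critical point coincide on a right
neighbourhood of the initial time. -/
theorem eq_right_of_three_point {E : Type*} [NormedAddCommGroup E] [NormedSpace ℝ E]
    [CompleteSpace E] {Ω : Set E} {f : E → E} (hfc : ContinuousOn f Ω) {C K : ℝ} (hC : 1 ≤ C)
    (hK : 1 ≤ K)
    (h3pt : ∀ a ∈ Ω, ∀ x ∈ Ω, ∀ y ∈ Ω, y ≠ a →
      ‖f x - f a‖ ≤
        C * max ((‖x - a‖ / ‖y - a‖) ^ K) ((‖x - a‖ / ‖y - a‖) ^ (1 / K)) *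
          ‖f y - f a‖)
    (hBV : ∀ a b : ℝ, a ≤ b → ∀ γ : ℝ → E,
      ContDiffOn ℝ 1 γ (Icc a b) → MapsTo γ (Icc a b) Ω →
      BoundedVariationOn (f ∘ γ) (Icc a b))
    {ε₀ : ℝ} (hε₀ : 0 < ε₀) {x y : ℝ → E}
    (hxΩ : ∀ t ∈ Ioo (-ε₀) ε₀, x t ∈ Ω) (hyΩ : ∀ t ∈ Ioo (-ε₀) ε₀, y t ∈ Ω)
    (hx : ∀ t ∈ Ioo (-ε₀) ε₀, HasDerivAt x (f (x t)) t)
    (hy : ∀ t ∈ Ioo (-ε₀) ε₀, HasDerivAt y (f (y t)) t)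
    (hxy : x 0 = y 0) (hfx : f (x 0) ≠ 0) :
    ∃ ε > (0 : ℝ), ∀ t ∈ Icc 0 ε, x t = y t := by
  have h0 : (0 : ℝ) ∈ Ioo (-ε₀) ε₀ := ⟨by linarith, hε₀⟩
  have hxc : ContinuousOn x (Ioo (-ε₀) ε₀) := HasDerivAt.continuousOn hx
  have hyc : ContinuousOn y (Ioo (-ε₀) ε₀) := HasDerivAt.continuousOn hy
  have hgc : ContinuousOn (f ∘ x) (Ioo (-ε₀) ε₀) := hfc.comp hxc hxΩ
  have hkc : ContinuousOn (f ∘ y) (Ioo (-ε₀) ε₀) := hfc.comp hyc hyΩ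
  set v := f (x 0) with hv
  have hv0 : 0 < ‖v‖ := norm_pos_iff.2 hfx
  obtain ⟨η, hη, hηε, hnear⟩ : ∃ η > 0, η < ε₀ ∧ ∀ t ∈ Icc 0 η, ‖f (x t) - v‖ ≤ ‖v‖ / 2 := by
    obtain ⟨δ, hδ, H⟩ := Metric.continuousAt_iff.1
      (hgc.continuousAt (Ioo_mem_nhds h0.1 h0.2)) (‖v‖ / 2) (by positivity)
    refine ⟨min δ ε₀ / 2, by positivity, by linarith [min_le_right δ ε₀], fun t ht ↦ ?_⟩
    have := @H t (by
      rw [Real.dist_eq, sub_zero, abs_of_nonneg ht.1]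
      linarith [ht.2, min_le_left δ ε₀, lt_min hδ hε₀])
    rw [dist_eq_norm] at this
    exact this.le
  have hsub : Icc 0 η ⊆ Ioo (-ε₀) ε₀ := fun t ht ↦ ⟨by linarith [ht.1], by linarith [ht.2]⟩
  have hlower : ∀ t D : ℝ, 0 ≤ t → 0 < D → t + D ≤ η → D * ‖v‖ / 2 ≤ ‖x (t + D) - x t‖ := by
    intro t D ht hD htD
    have H := (convex_Icc (0 : ℝ) η).norm_image_sub_le_of_norm_hasDerivWithin_le
      (f := fun s ↦ x s - s • v) (f' := fun s ↦ f (x s) - v) (x := t) (y := t + D)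
      (fun s hs ↦ ((hx s (hsub hs)).sub (by
        simpa using (hasDerivAt_id s).smul_const v)).hasDerivWithinAt) hnear
      ⟨ht, by linarith⟩ ⟨by linarith, htD⟩
    rw [show x (t + D) - (t + D) • v - (x t - t • v) = (x (t + D) - x t) - D • v by module,
      add_sub_cancel_left, Real.norm_of_nonneg hD.le] at H
    have h1 := norm_sub_norm_le (D • v) (x (t + D) - x t)
    rw [norm_sub_rev (D • v), norm_smul, Real.norm_of_nonneg hD.le] at h1
    linarith
  have hxC1 : ContDiffOn ℝ 1 x (Icc 0 η) := by
    refine (ContDiffOn.mono ?_ hsub)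
    rw [contDiffOn_one_iff_derivWithin isOpen_Ioo.uniqueDiffOn]
    refine ⟨fun t ht ↦ (hx t ht).differentiableAt.differentiableWithinAt, hgc.congr fun t ht ↦ ?_⟩
    rw [derivWithin_of_isOpen isOpen_Ioo ht, (hx t ht).deriv]
    rfl
  have hbv : LocallyBoundedVariationOn (f ∘ x) (Icc 0 η) :=
    (hBV 0 η hη.le x hxC1 fun t ht ↦ hxΩ t (hsub ht)).locallyBoundedVariationOn
  set M := C * max ((2 / ‖v‖) ^ K) ((2 / ‖v‖) ^ (1 / K)) with hM
  have hM0 : 0 < M := by positivity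
  have hη0 : (0 : ℝ) ∈ Icc 0 η := ⟨le_rfl, hη.le⟩
  obtain ⟨τ, hτ, hτη, hVτ⟩ : ∃ τ > 0, τ ≤ η ∧
      M * variationOnFromTo (f ∘ x) (Icc 0 η) 0 τ < 1 := by
    have hlim := variationOnFromTo.tendsto_right (f := f ∘ x) (l := (f ∘ x) 0) hη0 hη0 hbv
      ((hgc.mono hsub 0 hη0).mono inter_subset_left)
    rw [variationOnFromTo.self, dist_self, add_zero] at hlim
    have hne : (𝓝[Icc 0 η ∩ Ioi 0] (0 : ℝ)).NeBot := by
      have hgt : (𝓝[>] (0 : ℝ)).NeBot := inferInstance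
      rw [← nhdsWithin_Ioc_eq_nhdsGT hη] at hgt
      exact hgt.mono <| nhdsWithin_mono _ fun t ht ↦ ⟨⟨ht.1.le, ht.2⟩, ht.1⟩
    obtain ⟨τ, h1, h2⟩ := ((hlim.eventually (gt_mem_nhds (inv_pos.2 hM0))).and
      self_mem_nhdsWithin).exists
    refine ⟨τ, h2.2, h2.1.2, ?_⟩
    calc _ < M * M⁻¹ := by gcongr
      _ = 1 := mul_inv_cancel₀ hM0.ne'
  obtain ⟨T, hT, hTτ, hclose⟩ : ∃ T > 0, T ≤ τ / 2 ∧ ∀ t ∈ Icc 0 T, ‖x t - y t‖ ≤ τ / 2 := by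
    obtain ⟨δ, hδ, H⟩ := Metric.continuousAt_iff.1
      ((hxc.sub hyc).continuousAt (Ioo_mem_nhds h0.1 h0.2)) (τ / 2) (by positivity)
    refine ⟨min δ τ / 2, by positivity, by linarith [min_le_right δ τ], fun t ht ↦ ?_⟩
    have := @H t (by
      rw [Real.dist_eq, sub_zero, abs_of_nonneg ht.1]
      linarith [ht.2, min_le_left δ τ, lt_min hδ hτ])
    simp only [Pi.sub_apply, hxy, sub_self, dist_zero_right] at this
    exact this.le
  have hTη : Icc 0 T ⊆ Icc 0 η := Icc_subset_Icc_right (by linarith)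
  obtain ⟨s, hs, hmax⟩ := isCompact_Icc.exists_isMaxOn (nonempty_Icc.2 hT.le)
    (((hxc.sub hyc).mono (hTη.trans hsub)).norm)
  simp only [isMaxOn_iff, Pi.sub_apply] at hmax
  set D := ‖x s - y s‖ with hD
  suffices hD0 : D = 0 by
    exact ⟨T, hT, fun t ht ↦ sub_eq_zero.1 <| norm_le_zero_iff.1 <| (hmax t ht).trans_eq hD0⟩
  by_contra hDne
  have hDpos : 0 < D := lt_of_le_of_ne (norm_nonneg _) (Ne.symm hDne)
  have hsD : s + D ≤ τ := by linarith [hs.2, hclose s hs]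
  have hbound : ∀ t ∈ Icc 0 s, ‖f (x t) - f (y t)‖ ≤ M * ‖f (x (t + D)) - f (x t)‖ := by
    intro t ht
    have htT : t ∈ Icc 0 T := ⟨ht.1, ht.2.trans hs.2⟩
    have htD : t + D ∈ Icc 0 η := ⟨by linarith [ht.1], by linarith [ht.2]⟩
    have hlow := hlower t D ht.1 hDpos htD.2
    have hpos : 0 < ‖x (t + D) - x t‖ := lt_of_lt_of_le (by positivity) hlow
    have hratio : ‖y t - x t‖ / ‖x (t + D) - x t‖ ≤ 2 / ‖v‖ := by
      rw [div_le_div_iff₀ hpos hv0, norm_sub_rev]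
      nlinarith [hmax t htT]
    rw [norm_sub_rev]
    refine (h3pt (x t) (hxΩ t (hsub (hTη htT))) (y t) (hyΩ t (hsub (hTη htT))) (x (t + D))
      (hxΩ _ (hsub htD)) (sub_ne_zero.1 (norm_pos_iff.1 hpos))).trans ?_
    rw [hM]
    gcongr
  have hsη : Icc 0 s ⊆ Icc 0 η := (Icc_subset_Icc_right hs.2).trans hTη
  have hdiffc : ContinuousOn (fun t ↦ f (x t) - f (y t)) (Icc 0 s) :=
    (hgc.sub hkc).mono (hsη.trans hsub)
  have hFTC : ∫ t in (0 : ℝ)..s, (f (x t) - f (y t)) = x s - y s := by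
    rw [intervalIntegral.integral_eq_sub_of_hasDerivAt (f := fun t ↦ x t - y t)
      (fun t ht ↦ ?_) (hdiffc.intervalIntegrable_of_Icc hs.1), hxy, sub_self, sub_zero]
    rw [uIcc_of_le hs.1] at ht
    exact (hx t (hsub (hsη ht))).sub (hy t (hsub (hsη ht)))
  have hshift : ContinuousOn (fun t ↦ M * ‖f (x (t + D)) - f (x t)‖) (Icc 0 s) := by
    refine continuousOn_const.mul
      ((hgc.comp (f := fun t ↦ t + D) (by fun_prop) fun t ht ↦ ?_).sub
        (hgc.mono (hsη.trans hsub))).norm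
    exact hsub ⟨by linarith [ht.1], by linarith [ht.2]⟩
  have hmain : D ≤ D * (M * variationOnFromTo (f ∘ x) (Icc 0 η) 0 τ) :=
    calc D = ‖∫ t in (0 : ℝ)..s, (f (x t) - f (y t))‖ := by rw [hFTC]
      _ ≤ ∫ t in (0 : ℝ)..s, M * ‖f (x (t + D)) - f (x t)‖ :=
        intervalIntegral.norm_integral_le_of_norm_le hs.1
          (.of_forall fun t ht ↦ hbound t (Ioc_subset_Icc_self ht))
          (hshift.intervalIntegrable_of_Icc hs.1)
      _ ≤ M * (D * variationOnFromTo (f ∘ x) (Icc 0 η) 0 (s + D)) := by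
        rw [intervalIntegral.integral_const_mul]
        exact mul_le_mul_of_nonneg_left (integral_norm_sub_translate_le (g := f ∘ x)
          (hgc.mono hsub) hbv hs.1 hDpos (hsD.trans hτη)) hM0.le
      _ ≤ M * (D * variationOnFromTo (f ∘ x) (Icc 0 η) 0 τ) := by
        gcongr
        exact variationOnFromTo.monotoneOn hbv hη0
          ⟨by linarith [hs.1], hsD.trans hτη⟩ ⟨hτ.le, hτη⟩ hsD
      _ = _ := by ring
  nlinarith


/-- A continuous quasiconformal field (three-point condition) of bounded variation
on `C¹`-curves has unique local solutions through non-critical points. -/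
theorem stmt3 (n : ℕ) (Ω : Set (EuclideanSpace ℝ (Fin n))) (hΩ : IsOpen Ω)
    (f : EuclideanSpace ℝ (Fin n) → EuclideanSpace ℝ (Fin n))
    (hfc : ContinuousOn f Ω)
    (C K : ℝ) (hC : 1 ≤ C) (hK : 1 ≤ K)
    (h3pt : ∀ a ∈ Ω, ∀ x ∈ Ω, ∀ y ∈ Ω, y ≠ a →
      ‖f x - f a‖ ≤
        C * max ((‖x - a‖ / ‖y - a‖) ^ K) ((‖x - a‖ / ‖y - a‖) ^ (1 / K)) *
          ‖f y - f a‖)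
    (hBV : ∀ a b : ℝ, a ≤ b → ∀ γ : ℝ → EuclideanSpace ℝ (Fin n),
      ContDiffOn ℝ 1 γ (Set.Icc a b) → Set.MapsTo γ (Set.Icc a b) Ω →
      BoundedVariationOn (f ∘ γ) (Set.Icc a b))
    (a₀ : EuclideanSpace ℝ (Fin n)) (ha₀ : a₀ ∈ Ω) (hfa₀ : f a₀ ≠ 0)
    (ε₀ : ℝ) (hε₀ : 0 < ε₀) (x y : ℝ → EuclideanSpace ℝ (Fin n))
    (hxΩ : ∀ t ∈ Set.Ioo (-ε₀) ε₀, x t ∈ Ω)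
    (hyΩ : ∀ t ∈ Set.Ioo (-ε₀) ε₀, y t ∈ Ω)
    (hx : ∀ t ∈ Set.Ioo (-ε₀) ε₀, HasDerivAt x (f (x t)) t)
    (hy : ∀ t ∈ Set.Ioo (-ε₀) ε₀, HasDerivAt y (f (y t)) t)
    (hx0 : x 0 = a₀) (hy0 : y 0 = a₀) :
    ∃ ε > (0 : ℝ), ∀ t : ℝ, |t| < ε → x t = y t := by
  obtain ⟨ε₁, hε₁, h₁⟩ := eq_right_of_three_point hfc hC hK h3pt hBV hε₀ hxΩ hyΩ hx hy
    (hx0.trans hy0.symm) (by rwa [hx0])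
  have hneg : ∀ t ∈ Set.Ioo (-ε₀) ε₀, -t ∈ Set.Ioo (-ε₀) ε₀ := fun t ht ↦
    ⟨neg_lt_neg ht.2, by linarith [ht.1]⟩
  have hrev : ∀ z : ℝ → EuclideanSpace ℝ (Fin n),
      (∀ t ∈ Set.Ioo (-ε₀) ε₀, HasDerivAt z (f (z t)) t) →
      ∀ t ∈ Set.Ioo (-ε₀) ε₀, HasDerivAt (fun s ↦ z (-s)) (-f (z (-t))) t := fun z hz t ht ↦ by
    simpa [Function.comp_def] using (hz (-t) (hneg t ht)).scomp t (hasDerivAt_neg t)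
  obtain ⟨ε₂, hε₂, h₂⟩ := eq_right_of_three_point (f := fun p ↦ -f p) hfc.neg hC hK
    (fun a ha p hp q hq hqa ↦ by
      simpa only [neg_sub_neg, norm_sub_rev (f a)] using h3pt a ha p hp q hq hqa)
    (fun a b hab γ hγ hγΩ ↦ (LipschitzWith.id.neg).comp_boundedVariationOn (hBV a b hab γ hγ hγΩ))
    hε₀ (x := fun s ↦ x (-s)) (y := fun s ↦ y (-s))
    (fun t ht ↦ hxΩ _ (hneg t ht)) (fun t ht ↦ hyΩ _ (hneg t ht)) (hrev x hx) (hrev y hy)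
    (by simp [hx0, hy0]) (by simpa [hx0] using hfa₀)
  refine ⟨min ε₁ ε₂, lt_min hε₁ hε₂, fun t ht ↦ ?_⟩
  obtain ⟨hl, hr⟩ := abs_lt.1 ht
  rcases le_total 0 t with h | h
  · exact h₁ t ⟨h, (hr.trans_le (min_le_left _ _)).le⟩
  · simpa using h₂ (-t) ⟨by linarith, by linarith [min_le_right ε₁ ε₂]⟩
end

section
/- Let f : ℂ → ℂ be a homeomorphism of the plane onto itself satisfying the three-point condition with constants C ≥ 1 and K ≥ 1 on ℂ. Let z : [α, β] → ℂ be an injective continuously differentiable curve with |z′(t)| = 1 for all t ∈ [α, β]. Then the quadratic variation of f along z is finite: there exists M < ∞ such that for every partition α = t₀ < t₁ < ⋯ < t_N = β one has Σ_{j=1}^N (diam f(z([t_{j−1}, t_j])))² ≤ M. -/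
open MeasureTheory in
/-- Pairwise disjoint disks inside a set of finite area have square-summable radii. -/
lemma sum_sq_radius_le_of_disjoint_ball {ι : Type*} [Fintype ι] {c : ι → ℂ} {r : ι → ℝ} {S : Set ℂ}
    (hS : volume S ≠ ⊤) (hr : ∀ i, 0 ≤ r i) (hsub : ∀ i, Metric.ball (c i) (r i) ⊆ S)
    (hdisj : Pairwise (Function.onFun Disjoint fun i => Metric.ball (c i) (r i))) :
    ∑ i, r i ^ 2 ≤ volume.real S := by
  have hball : ∀ i, volume.real (Metric.ball (c i) (r i)) = r i ^ 2 * Real.pi := fun i => by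
    simp [Measure.real, Complex.volume_ball, ENNReal.toReal_ofReal (hr i)]
  have hunion : volume.real (⋃ i, Metric.ball (c i) (r i)) =
      ∑ i, volume.real (Metric.ball (c i) (r i)) :=
    measureReal_iUnion_fintype hdisj (fun _ => measurableSet_ball)
      (fun _ => measure_ball_lt_top.ne)
  calc ∑ i, r i ^ 2 ≤ ∑ i, volume.real (Metric.ball (c i) (r i)) := by
        refine Finset.sum_le_sum fun i _ => ?_
        rw [hball]
        nlinarith [sq_nonneg (r i), Real.pi_gt_three]
    _ ≤ volume.real S := by
        rw [← hunion]
        exact measureReal_mono (Set.iUnion_subset hsub) hS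

/-- An injective `C¹` arc parametrized by arc length has a Lipschitz inverse. -/
lemma exists_dist_le_mul_norm_sub_of_unit_speed {α β : ℝ} {z z' : ℝ → ℂ}
    (hz : ∀ t ∈ Set.Icc α β, HasDerivAt z (z' t) t)
    (hz'c : ContinuousOn z' (Set.Icc α β))
    (hunit : ∀ t ∈ Set.Icc α β, ‖z' t‖ = 1)
    (hinj : Set.InjOn z (Set.Icc α β)) :
    ∃ L : ℝ, 1 ≤ L ∧ ∀ s ∈ Set.Icc α β, ∀ t ∈ Set.Icc α β, |t - s| ≤ L * ‖z t - z s‖ := by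
  obtain ⟨δ, hδ, hclose⟩ := Metric.uniformContinuousOn_iff.1
    (isCompact_Icc.uniformContinuousOn_of_continuous hz'c) (1 / 2) (by norm_num)
  have hnear : ∀ s ∈ Set.Icc α β, ∀ t ∈ Set.Icc α β, |t - s| < δ →
      |t - s| ≤ 2 * ‖z t - z s‖ := by
    intro s hs t ht hst
    have hsub : Set.uIcc s t ⊆ Set.Icc α β := Set.uIcc_subset_Icc hs ht
    have hmv := (convex_uIcc s t).norm_image_sub_le_of_norm_hasDerivWithin_le
      (f := fun u : ℝ => z u - (u : ℂ) * z' s) (f' := fun u => z' u - 1 * z' s) (C := 1 / 2)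
      (fun u hu => ((hz u (hsub hu)).sub
        ((Complex.ofRealCLM.hasDerivAt (x := u)).mul_const (z' s))).hasDerivWithinAt)
      (fun u hu => by
        have hus : |u - s| ≤ |t - s| := Set.abs_sub_left_of_mem_uIcc hu
        have := hclose u (hsub hu) s hs (by rw [Real.dist_eq]; linarith)
        rw [dist_eq_norm] at this
        simpa using this.le)
      Set.left_mem_uIcc Set.right_mem_uIcc
    have hlin : ‖((t - s : ℝ) : ℂ) * z' s‖ = |t - s| := by
      rw [norm_mul, hunit s hs, Complex.norm_real, Real.norm_eq_abs, mul_one]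
    have htri := norm_sub_norm_le (((t - s : ℝ) : ℂ) * z' s) (z t - z s)
    have heq : ‖((t - s : ℝ) : ℂ) * z' s - (z t - z s)‖ =
        ‖z t - (t : ℂ) * z' s - (z s - (s : ℂ) * z' s)‖ := by
      rw [← norm_neg]
      congr 1
      push_cast
      ring
    rw [Real.norm_eq_abs] at hmv
    rw [heq, hlin] at htri
    linarith
  have hzc : ContinuousOn z (Set.Icc α β) := fun t ht => (hz t ht).continuousAt.continuousWithinAt
  obtain ⟨m, hm, hfar⟩ : ∃ m : ℝ, 0 < m ∧ ∀ p ∈ (Set.Icc α β ×ˢ Set.Icc α β) ∩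
      {p : ℝ × ℝ | δ ≤ |p.2 - p.1|}, m ≤ ‖z p.2 - z p.1‖ := by
    refine IsCompact.exists_forall_le' ?_ ?_ ?_
    · exact (isCompact_Icc.prod isCompact_Icc).inter_right
        (isClosed_le continuous_const (by fun_prop))
    · exact ((hzc.comp continuousOn_snd fun p hp => hp.1.2).sub
        (hzc.comp continuousOn_fst fun p hp => hp.1.1)).norm
    · rintro ⟨s, t⟩ ⟨⟨hs, ht⟩, hst⟩
      refine norm_pos_iff.2 (sub_ne_zero.2 fun h => ?_)
      have hts : t = s := hinj ht hs h
      simp only [Set.mem_ofPred_eq, hts, sub_self, abs_zero] at hst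
      linarith
  refine ⟨max 2 ((β - α) / m), le_max_of_le_left (by norm_num), fun s hs t ht => ?_⟩
  rcases lt_or_ge |t - s| δ with h | h
  · exact (hnear s hs t ht h).trans (by gcongr; exact le_max_left _ _)
  · have hmle : m ≤ ‖z t - z s‖ := hfar (s, t) ⟨⟨hs, ht⟩, h⟩
    have hlen : |t - s| ≤ β - α := by
      rw [abs_le]; constructor <;> linarith [hs.1, hs.2, ht.1, ht.2]
    have hlen0 : 0 ≤ β - α := (abs_nonneg _).trans hlen
    calc |t - s| ≤ (β - α) / m * m := by rwa [div_mul_cancel₀ _ hm.ne']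
      _ ≤ max 2 ((β - α) / m) * ‖z t - z s‖ := by gcongr; exact le_max_right _ _

/-- A quasiconformal (three-point condition) homeomorphism of the plane has finite
quadratic variation along every injective `C¹` arc parametrized by arc length. -/
theorem stmt4 (f : ℂ → ℂ) (hhomeo : IsHomeomorph f)
    (C K : ℝ) (hC : 1 ≤ C) (hK : 1 ≤ K)
    (h3pt : ∀ a x y : ℂ, y ≠ a →
      ‖f x - f a‖ ≤
        C * max ((‖x - a‖ / ‖y - a‖) ^ K) ((‖x - a‖ / ‖y - a‖) ^ (1 / K)) *
          ‖f y - f a‖)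
    (α β : ℝ) (hαβ : α ≤ β) (z z' : ℝ → ℂ)
    (hz : ∀ t ∈ Set.Icc α β, HasDerivAt z (z' t) t)
    (hz'c : ContinuousOn z' (Set.Icc α β))
    (hunit : ∀ t ∈ Set.Icc α β, ‖z' t‖ = 1)
    (hinj : Set.InjOn z (Set.Icc α β)) :
    ∃ M : ℝ, ∀ (N : ℕ) (t : Fin (N + 1) → ℝ), StrictMono t →
      t 0 = α → t (Fin.last N) = β →
      ∑ j : Fin N,
        (Metric.diam (f '' (z '' Set.Icc (t j.castSucc) (t j.succ)))) ^ 2 ≤ M := by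
  obtain ⟨L, hL, hlow⟩ := exists_dist_le_mul_norm_sub_of_unit_speed hz hz'c hunit hinj
  have hL0 : 0 < L := by linarith
  have hlip : ∀ s ∈ Set.Icc α β, ∀ t ∈ Set.Icc α β, ‖z t - z s‖ ≤ |t - s| := fun s hs t ht => by
    simpa using (convex_Icc α β).norm_image_sub_le_of_norm_hasDerivWithin_le
      (fun u hu => (hz u hu).hasDerivWithinAt) (fun u hu => (hunit u hu).le) hs ht
  set H : ℝ := C * max (L ^ K) (L ^ (1 / K)) with hH
  have hH0 : 0 < H := mul_pos (by linarith) (lt_max_of_lt_left (Real.rpow_pos_of_pos hL0 K))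
  have hdistort : ∀ a x y : ℂ, y ≠ a → ‖x - a‖ ≤ L * ‖y - a‖ →
      ‖f x - f a‖ ≤ H * ‖f y - f a‖ := by
    intro a x y hya hxy
    have hpos : 0 < ‖y - a‖ := norm_pos_iff.2 (sub_ne_zero.2 hya)
    have hratio : ‖x - a‖ / ‖y - a‖ ≤ L := (div_le_iff₀ hpos).2 hxy
    refine (h3pt a x y hya).trans ?_
    rw [hH]
    gcongr
  set S : Set ℂ := f '' Metric.closedBall (z α) (2 * (β - α)) with hS
  have hSfin : MeasureTheory.volume S ≠ ⊤ :=
    ((isCompact_closedBall _ _).image hhomeo.continuous).measure_lt_top.ne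
  refine ⟨(2 * H) ^ 2 * MeasureTheory.volume.real S, fun N t ht ht0 htN => ?_⟩
  have hmem : ∀ i, t i ∈ Set.Icc α β := fun i =>
    ⟨ht0 ▸ ht.monotone (Fin.zero_le i), htN ▸ ht.monotone (Fin.le_last i)⟩
  have hlt : ∀ j : Fin N, t j.castSucc < t j.succ := fun j => ht j.castSucc_lt_succ
  set mid : Fin N → ℝ := fun j => (t j.castSucc + t j.succ) / 2 with hmid
  set len : Fin N → ℝ := fun j => t j.succ - t j.castSucc with hlen
  have hlenpos : ∀ j, 0 < len j := fun j => sub_pos.2 (hlt j)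
  have hmidmem : ∀ j, mid j ∈ Set.Icc α β := fun j => by
    have h1 := hmem j.castSucc
    have h2 := hmem j.succ
    constructor <;> simp only [hmid] <;> linarith [h1.1, h1.2, h2.1, h2.2]
  set B : Fin N → Set ℂ := fun j => Metric.ball (z (mid j)) (len j / (2 * L)) with hB
  set D : Fin N → ℝ := fun j => Metric.diam (f '' (z '' Set.Icc (t j.castSucc) (t j.succ))) with hD
  have hDle : ∀ j, ∀ y ∉ B j, D j ≤ 2 * H * ‖f y - f (z (mid j))‖ := by
    intro j y hy
    have hfar : len j / (2 * L) ≤ ‖y - z (mid j)‖ := by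
      simpa [hB, dist_eq_norm] using hy
    have hrad : 0 < len j / (2 * L) := div_pos (hlenpos j) (by linarith)
    have hya : y ≠ z (mid j) := fun h => by
      rw [h, sub_self, norm_zero] at hfar
      linarith
    have hpt : ∀ u ∈ Set.Icc (t j.castSucc) (t j.succ),
        ‖f (z u) - f (z (mid j))‖ ≤ H * ‖f y - f (z (mid j))‖ := by
      intro u hu
      refine hdistort _ _ _ hya ?_
      have humem : u ∈ Set.Icc α β :=
        ⟨(hmem j.castSucc).1.trans hu.1, hu.2.trans (hmem j.succ).2⟩
      calc ‖z u - z (mid j)‖ ≤ |u - mid j| := hlip _ (hmidmem j) _ humem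
        _ ≤ len j / 2 := by
            rw [abs_le]
            constructor <;> simp only [hmid, hlen] <;> linarith [hu.1, hu.2]
        _ = L * (len j / (2 * L)) := by field_simp
        _ ≤ L * ‖y - z (mid j)‖ := by gcongr
    refine Metric.diam_le_of_forall_dist_le (by positivity) ?_
    rintro _ ⟨_, ⟨u, hu, rfl⟩, rfl⟩ _ ⟨_, ⟨v, hv, rfl⟩, rfl⟩
    have htri := dist_triangle_right (f (z u)) (f (z v)) (f (z (mid j)))
    rw [dist_eq_norm (f (z u)) (f (z (mid j))), dist_eq_norm (f (z v)) (f (z (mid j)))] at htri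
    linarith [hpt u hu, hpt v hv]
  have hsubB : ∀ j, Metric.ball (f (z (mid j))) (D j / (2 * H)) ⊆ f '' B j := by
    intro j w hw
    obtain ⟨y, rfl⟩ := hhomeo.surjective w
    refine ⟨y, by_contra fun hy => ?_, rfl⟩
    rw [Metric.mem_ball, dist_eq_norm, lt_div_iff₀ (by positivity)] at hw
    linarith [hDle j y hy]
  have hBsub : ∀ j, B j ⊆ Metric.closedBall (z α) (2 * (β - α)) := by
    intro j
    refine Metric.ball_subset_closedBall.trans (Metric.closedBall_subset_closedBall' ?_)
    have h1 : dist (z (mid j)) (z α) ≤ β - α := by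
      rw [dist_eq_norm]
      refine (hlip α (Set.left_mem_Icc.2 hαβ) _ (hmidmem j)).trans ?_
      rw [abs_of_nonneg (by linarith [(hmidmem j).1])]
      linarith [(hmidmem j).2]
    have h2 : len j / (2 * L) ≤ len j := div_le_self (hlenpos j).le (by linarith)
    have h3 : len j ≤ β - α := by
      simp only [hlen]
      linarith [(hmem j.succ).2, (hmem j.castSucc).1]
    linarith
  have hdisjlt : ∀ i j : Fin N, i < j → Disjoint (B i) (B j) := by
    intro i j hij
    refine Metric.ball_disjoint_ball ?_
    have hord : t i.succ ≤ t j.castSucc := ht.monotone (Fin.succ_le_castSucc_iff.2 hij)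
    have h := hlow _ (hmidmem j) _ (hmidmem i)
    rw [← dist_eq_norm] at h
    have h' := (neg_le_abs (mid i - mid j)).trans h
    have hgap : (len i + len j) / 2 ≤ L * dist (z (mid i)) (z (mid j)) := by
      refine le_trans ?_ h'
      simp only [hmid, hlen]
      linarith
    rw [← add_div, div_le_iff₀ (by positivity)]
    linarith
  have hdisj : Pairwise (Function.onFun Disjoint
      fun j => Metric.ball (f (z (mid j))) (D j / (2 * H))) := by
    intro i j hij
    refine Disjoint.mono (hsubB i) (hsubB j) ((Set.disjoint_image_iff hhomeo.injective).2 ?_)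
    rcases hij.lt_or_gt with h | h
    · exact hdisjlt i j h
    · exact (hdisjlt j i h).symm
  have hmain := sum_sq_radius_le_of_disjoint_ball hSfin
    (fun j => div_nonneg Metric.diam_nonneg (by positivity))
    (fun j => (hsubB j).trans (Set.image_mono (hBsub j))) hdisj
  calc ∑ j, D j ^ 2 = (2 * H) ^ 2 * ∑ j, (D j / (2 * H)) ^ 2 := by
        rw [Finset.mul_sum]
        refine Finset.sum_congr rfl fun j _ => ?_
        field_simp
    _ ≤ _ := by gcongr
end

section
/- For all constants C ≥ 1 and K ≥ 1 there exists a constant C′ < ∞, depending only on C and K, with the following property. Let f : ℂ → ℂ be a homeomorphism of the plane onto itself satisfying the three-point condition with constants C and K on ℂ, and let z : [α, β] → ℂ be continuously differentiable with |z′(t)| = 1 for all t and |z′(t) − z′(s)| ≤ √2/2 for all t, s ∈ [α, β]. Then for every partition α = t₀ < t₁ < ⋯ < t_N = β one has Σ_{j=1}^N (diam f(z([t_{j−1}, t_j])))² ≤ C′·(diam f(z([α, β])))². -/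
open MeasureTheory in
/-- Area comparison for disjoint discs contained in a disc. -/
theorem Complex.sum_sq_radius_le_of_disjoint_balls {ι : Type*} [Fintype ι] (c : ι → ℂ)
    (r : ι → ℝ) (hr : ∀ i, 0 ≤ r i) (c₀ : ℂ) (R : ℝ) (hR : 0 ≤ R)
    (hd : Pairwise fun i j => Disjoint (Metric.ball (c i) (r i)) (Metric.ball (c j) (r j)))
    (hsub : ∀ i, Metric.ball (c i) (r i) ⊆ Metric.ball c₀ R) :
    ∑ i, r i ^ 2 ≤ R ^ 2 := by
  have h : ∑ i, volume.real (Metric.ball (c i) (r i)) ≤ volume.real (Metric.ball c₀ R) := by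
    rw [← measureReal_iUnion_fintype hd (fun i => measurableSet_ball)
      (fun i => measure_ball_lt_top.ne)]
    exact measureReal_mono (Set.iUnion_subset hsub) measure_ball_lt_top.ne
  have hv : ∀ (a : ℂ) (ρ : ℝ), 0 ≤ ρ → volume.real (Metric.ball a ρ) = ρ ^ 2 * Real.pi := by
    intro a ρ hρ
    simp [Measure.real, Complex.volume_ball, hρ]
  rw [Finset.sum_congr rfl fun i _ => hv (c i) (r i) (hr i), hv c₀ R hR, ← Finset.sum_mul] at h
  exact le_of_mul_le_mul_right h Real.pi_pos

/-- A curve of unit speed whose tangent oscillates by at most `θ` satisfies a chord-arc bound. -/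
theorem mul_sub_le_norm_sub_of_tangent_oscillation {E : Type*} [NormedAddCommGroup E]
    [NormedSpace ℝ E] {α β θ : ℝ} {z z' : ℝ → E}
    (hz : ∀ t ∈ Set.Icc α β, HasDerivAt z (z' t) t) (h1 : ∀ t ∈ Set.Icc α β, ‖z' t‖ = 1)
    (hosc : ∀ t ∈ Set.Icc α β, ∀ s ∈ Set.Icc α β, ‖z' t - z' s‖ ≤ θ)
    {s t : ℝ} (hs : s ∈ Set.Icc α β) (ht : t ∈ Set.Icc α β) (hst : s ≤ t) :
    (1 - θ) * (t - s) ≤ ‖z t - z s‖ := by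
  have hder : ∀ u ∈ Set.Icc α β,
      HasDerivWithinAt (fun u => z u - u • z' s) (z' u - z' s) (Set.Icc α β) u := by
    intro u hu
    simpa [Pi.sub_def] using
      ((hz u hu).sub ((hasDerivAt_id u).smul_const (z' s))).hasDerivWithinAt (s := Set.Icc α β)
  have h := (convex_Icc α β).norm_image_sub_le_of_norm_hasDerivWithin_le hder
    (fun u hu => hosc u hu s hs) hs ht
  have hsplit : z t - t • z' s - (z s - s • z' s) = (z t - z s) - (t - s) • z' s := by
    rw [sub_smul]; abel
  rw [hsplit, Real.norm_of_nonneg (sub_nonneg.2 hst)] at h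
  have h2 : ‖(t - s) • z' s‖ = t - s := by
    rw [norm_smul, h1 s hs, Real.norm_of_nonneg (sub_nonneg.2 hst), mul_one]
  have h3 := norm_sub_norm_le ((t - s) • z' s) (z t - z s)
  rw [h2, norm_sub_rev (_ • _)] at h3
  linarith

/-- The distortion function of the three-point condition is bounded by `M ^ K` on `[0, M]`. -/
theorem max_rpow_rpow_inv_le {K M r : ℝ} (hK : 1 ≤ K) (hM : 1 ≤ M) (hr : 0 ≤ r) (hrM : r ≤ M) :
    max (r ^ K) (r ^ (1 / K)) ≤ M ^ K := by
  have hK0 : 0 < K := by linarith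
  refine max_le (Real.rpow_le_rpow hr hrM hK0.le) ?_
  refine (Real.rpow_le_rpow hr hrM (by positivity)).trans ?_
  refine Real.rpow_le_rpow_of_exponent_le hM ?_
  exact ((div_le_one hK0).2 hK).trans hK

/-- Uniform quadratic-variation bound: for every `C ≥ 1`, `K ≥ 1` there is `C′`
such that for every quasiconformal homeomorphism of the plane (three-point
condition with constants `C`, `K`) and every arc-length parametrized `C¹` curve
whose tangent oscillates by at most `√2/2`, the quadratic variation of `f` along
the curve is at most `C′ · (diam f(z[α,β]))²`. -/
theorem stmt5 (C K : ℝ) (hC : 1 ≤ C) (hK : 1 ≤ K) :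
    ∃ C' : ℝ, ∀ f : ℂ → ℂ, IsHomeomorph f →
      (∀ a x y : ℂ, y ≠ a →
        ‖f x - f a‖ ≤
          C * max ((‖x - a‖ / ‖y - a‖) ^ K) ((‖x - a‖ / ‖y - a‖) ^ (1 / K)) *
            ‖f y - f a‖) →
      ∀ (α β : ℝ), α ≤ β → ∀ z z' : ℝ → ℂ,
        (∀ t ∈ Set.Icc α β, HasDerivAt z (z' t) t) →
        ContinuousOn z' (Set.Icc α β) →
        (∀ t ∈ Set.Icc α β, ‖z' t‖ = 1) →
        (∀ t ∈ Set.Icc α β, ∀ s ∈ Set.Icc α β, ‖z' t - z' s‖ ≤ Real.sqrt 2 / 2) →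
        ∀ (N : ℕ) (t : Fin (N + 1) → ℝ), StrictMono t →
          t 0 = α → t (Fin.last N) = β →
          ∑ j : Fin N,
              (Metric.diam (f '' (z '' Set.Icc (t j.castSucc) (t j.succ)))) ^ 2 ≤
            C' * (Metric.diam (f '' (z '' Set.Icc α β))) ^ 2 := by
  have hK4 : 1 ≤ (4 : ℝ) ^ K := Real.one_le_rpow (by norm_num) (by linarith)
  set A : ℝ := C * 4 ^ K with hA
  have hA1 : 1 ≤ A := one_le_mul_of_one_le_of_one_le hC hK4
  have hA0 : 0 < A := by linarith
  refine ⟨16 * A ^ 2, ?_⟩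
  intro f hf h3 α β hαβ z z' hz hz' hunit hosc N t ht ht0 htN
  have hthree : ∀ a x y : ℂ, y ≠ a → ‖x - a‖ ≤ 4 * ‖y - a‖ →
      ‖f x - f a‖ ≤ A * ‖f y - f a‖ := by
    intro a x y hy hxy
    have hpos : 0 < ‖y - a‖ := norm_pos_iff.2 (sub_ne_zero.2 hy)
    refine (h3 a x y hy).trans ?_
    have := max_rpow_rpow_inv_le hK (by norm_num : (1 : ℝ) ≤ 4)
      (div_nonneg (norm_nonneg (x - a)) hpos.le) ((div_le_iff₀ hpos).2 hxy)
    rw [hA]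
    gcongr
  have hzc : ContinuousOn z (Set.Icc α β) := fun u hu => (hz u hu).continuousAt.continuousWithinAt
  have hchord : ∀ s ∈ Set.Icc α β, ∀ u ∈ Set.Icc α β, s ≤ u → (u - s) / 4 ≤ ‖z u - z s‖ := by
    intro s hs u hu hsu
    have h := mul_sub_le_norm_sub_of_tangent_oscillation hz hunit hosc hs hu hsu
    have h2 : Real.sqrt 2 ≤ 3 / 2 := Real.sqrt_le_iff.2 ⟨by norm_num, by norm_num⟩
    nlinarith
  have hlip : ∀ s ∈ Set.Icc α β, ∀ u ∈ Set.Icc α β, ‖z u - z s‖ ≤ |u - s| := by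
    intro s hs u hu
    simpa using (convex_Icc α β).norm_image_sub_le_of_norm_hasDerivWithin_le
      (fun v hv => (hz v hv).hasDerivWithinAt) (fun v hv => (hunit v hv).le) hs hu
  have hmem : ∀ i, t i ∈ Set.Icc α β := fun i =>
    ⟨ht0 ▸ ht.monotone (Fin.zero_le i), htN ▸ ht.monotone (Fin.le_last i)⟩
  have hlt : ∀ j : Fin N, t j.castSucc < t j.succ := fun j => ht Fin.castSucc_lt_succ
  have hsubI : ∀ j : Fin N, Set.Icc (t j.castSucc) (t j.succ) ⊆ Set.Icc α β := fun j =>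
    Set.Icc_subset_Icc (hmem _).1 (hmem _).2
  set D : ℝ := Metric.diam (f '' (z '' Set.Icc α β)) with hD
  set d : Fin N → ℝ := fun j =>
    Metric.diam (f '' (z '' Set.Icc (t j.castSucc) (t j.succ))) with hd
  set m : Fin N → ℝ := fun j => (t j.castSucc + t j.succ) / 2 with hm
  have hmj : ∀ j, m j ∈ Set.Icc (t j.castSucc) (t j.succ) := by
    intro j
    have := hlt j
    simp only [hm]
    constructor <;> linarith
  have hmI : ∀ j, m j ∈ Set.Icc α β := fun j => hsubI j (hmj j)
  have hbdd : Bornology.IsBounded (f '' (z '' Set.Icc α β)) :=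
    ((isCompact_Icc.image_of_continuousOn hzc).image hf.continuous).isBounded
  have hD0 : 0 ≤ D := Metric.diam_nonneg
  have hd0 : ∀ j, 0 ≤ d j := fun j => Metric.diam_nonneg
  have hdD : ∀ j, d j ≤ D := fun j =>
    Metric.diam_mono (Set.image_mono (Set.image_mono (hsubI j))) hbdd
  have hdiam : ∀ j y, (t j.succ - t j.castSucc) / 8 ≤ ‖y - z (m j)‖ →
      d j ≤ 2 * (A * ‖f y - f (z (m j))‖) := by
    intro j y hy
    have hlj := hlt j
    have hya : y ≠ z (m j) := by
      rintro rfl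
      rw [sub_self, norm_zero] at hy
      linarith
    refine (Metric.diam_mono (t := Metric.closedBall (f (z (m j))) (A * ‖f y - f (z (m j))‖))
      ?_ Metric.isBounded_closedBall).trans (Metric.diam_closedBall (by positivity))
    rintro _ ⟨_, ⟨u, hu, rfl⟩, rfl⟩
    rw [mem_closedBall_iff_norm]
    refine hthree _ _ _ hya ((hlip _ (hmI j) u (hsubI j hu)).trans ?_)
    have : |u - m j| ≤ (t j.succ - t j.castSucc) / 2 := by
      simp only [hm, abs_le]
      constructor <;> linarith [hu.1, hu.2]
    linarith
  have hball : ∀ j y, f y ∈ Metric.ball (f (z (m j))) (d j / (2 * A)) →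
      ‖y - z (m j)‖ < (t j.succ - t j.castSucc) / 8 := by
    intro j y hy
    by_contra! hcon
    rw [mem_ball_iff_norm, lt_div_iff₀ (by positivity)] at hy
    linarith [hdiam j y hcon]
  have hsep : ∀ i j, i < j → Disjoint (Metric.ball (f (z (m i))) (d i / (2 * A)))
      (Metric.ball (f (z (m j))) (d j / (2 * A))) := by
    intro i j hij
    rw [Set.disjoint_left]
    intro w hwi hwj
    obtain ⟨y, rfl⟩ := hf.surjective w
    have hi := hball i y hwi
    have hj := hball j y hwj
    have hle : t i.succ ≤ t j.castSucc := ht.monotone (Fin.succ_le_castSucc_iff.2 hij)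
    have hli := hlt i
    have hlj := hlt j
    have hc := hchord _ (hmI i) _ (hmI j) (by simp only [hm]; linarith)
    have htri := norm_sub_le_norm_sub_add_norm_sub (z (m j)) y (z (m i))
    rw [norm_sub_rev (z (m j)) y] at htri
    simp only [hm] at hi hj hc htri
    linarith
  have hpack := Complex.sum_sq_radius_le_of_disjoint_balls (fun j => f (z (m j)))
    (fun j => d j / (2 * A)) (fun j => div_nonneg (hd0 j) (by positivity)) (f (z α)) (2 * D)
    (by positivity)
    (fun i j hij => (lt_or_gt_of_ne hij).elim (hsep i j) fun h => (hsep j i h).symm) (by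
      intro j
      refine Metric.ball_subset_ball' ?_
      have h1 : dist (f (z (m j))) (f (z α)) ≤ D :=
        Metric.dist_le_diam_of_mem hbdd
          (Set.mem_image_of_mem f (Set.mem_image_of_mem z (hmI j)))
          (Set.mem_image_of_mem f (Set.mem_image_of_mem z (Set.left_mem_Icc.2 hαβ)))
      have h2 : d j / (2 * A) ≤ D := (div_le_self (hd0 j) (by linarith)).trans (hdD j)
      linarith)
  simp only [div_pow] at hpack
  rw [← Finset.sum_div, div_le_iff₀ (by positivity)] at hpack
  refine hpack.trans (le_of_eq ?_)
  ring
end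

section
/- Let t₀ ∈ ℝ and let x, y : (−∞, t₀] → ℝⁿ be continuous functions such that lim_{t→−∞} x(t) and lim_{t→−∞} y(t) exist and are equal, while x(t₀) ≠ y(t₀). Then there exists a strictly decreasing sequence (t_k)_{k≥0} with the given t₀ as its first term such that for every k ≥ 0: inf{ |x(t) − y(s)| : t, s ∈ [t_{k+1}, t_k] } = t_k − t_{k+1}; moreover, either t_k → −∞, or t_k converges to some finite t_∞ with x(t_∞) = y(t_∞). -/
/-- The infimum of `‖x p - y q‖` over `p, q ∈ [u - h, u]` equals `h` for some `h > 0`. -/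
lemma exists_pos_sInf_norm_sub_eq {E : Type*} [NormedAddCommGroup E] {x y : ℝ → E}
    (hx : Continuous x) (hy : Continuous y) {u : ℝ} (hu : x u ≠ y u) :
    ∃ h : ℝ, 0 < h ∧ sInf ((fun p : ℝ × ℝ => ‖x p.1 - y p.2‖) ''
      (Set.Icc (u - h) u ×ˢ Set.Icc (u - h) u)) = h := by
  let K : Set (ℝ × ℝ) := Set.Icc 0 1 ×ˢ Set.Icc 0 1
  let f : ℝ → ℝ × ℝ → ℝ := fun h p => ‖x (u - h * p.1) - y (u - h * p.2)‖
  have hK : IsCompact K := isCompact_Icc.prod isCompact_Icc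
  have hcont : Continuous fun h => sInf (f h '' K) := by
    refine hK.continuous_sInf ?_
    change Continuous fun q : ℝ × ℝ × ℝ => ‖x (u - q.1 * q.2.1) - y (u - q.1 * q.2.2)‖
    fun_prop
  have h_zero_mem : ((0, 0) : ℝ × ℝ) ∈ K := by simp [K]
  have hbdd (h : ℝ) : BddBelow (f h '' K) :=
    ⟨0, by rintro _ ⟨p, -, rfl⟩; exact norm_nonneg _⟩
  set d := ‖x u - y u‖ with hd
  have hdpos : 0 < d := norm_pos_iff.2 (sub_ne_zero.2 hu)
  have hle (h : ℝ) : sInf (f h '' K) ≤ d :=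
    csInf_le (hbdd h) ⟨(0, 0), h_zero_mem, by simp [f, hd]⟩
  have hzero : sInf (f 0 '' K) = d := by
    have : f 0 '' K = {d} := by
      rw [← Set.Nonempty.image_const ⟨_, h_zero_mem⟩ d]
      exact Set.image_congr fun p _ => by simp [f, hd]
    rw [this, csInf_singleton]
  obtain ⟨h, hh, heq⟩ : (0 : ℝ) ∈ (fun h => sInf (f h '' K) - h) '' Set.Icc 0 d := by
    refine intermediate_value_Icc' hdpos.le (by fun_prop) ⟨?_, ?_⟩
    · linarith [hle d]
    · simp only [hzero]; linarith
  simp only at heq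
  have hpos : 0 < h := by
    refine lt_of_le_of_ne hh.1 ?_
    rintro rfl
    rw [hzero] at heq
    linarith
  refine ⟨h, hpos, ?_⟩
  suffices (fun p : ℝ × ℝ => ‖x p.1 - y p.2‖) '' (Set.Icc (u - h) u ×ˢ Set.Icc (u - h) u) =
      f h '' K by rw [this]; linarith
  have hrange : ∀ a ∈ Set.Icc (0 : ℝ) 1, u - h * a ∈ Set.Icc (u - h) u := fun a ha =>
    ⟨by nlinarith [ha.2], by nlinarith [ha.1]⟩
  have hlift : ∀ a ∈ Set.Icc (u - h) u, (u - a) / h ∈ Set.Icc (0 : ℝ) 1 := fun a ha =>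
    ⟨div_nonneg (by linarith [ha.2]) hpos.le, (div_le_one hpos).2 (by linarith [ha.1])⟩
  have hinv (a : ℝ) : u - h * ((u - a) / h) = a := by field_simp; ring
  ext r
  constructor
  · rintro ⟨p, ⟨h₁, h₂⟩, rfl⟩
    exact ⟨((u - p.1) / h, (u - p.2) / h), ⟨hlift _ h₁, hlift _ h₂⟩, by simp only [f, hinv]⟩
  · rintro ⟨p, ⟨h₁, h₂⟩, rfl⟩
    exact ⟨(u - h * p.1, u - h * p.2), ⟨hrange _ h₁, hrange _ h₂⟩, rfl⟩

/-- A minimizing pair for `‖x p - y q‖` on a square `[a, b] × [a, b]`. -/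
lemma exists_norm_sub_eq_sInf {E : Type*} [NormedAddCommGroup E] {x y : ℝ → E}
    (hx : Continuous x) (hy : Continuous y) {a b : ℝ} (hab : a ≤ b) :
    ∃ p ∈ Set.Icc a b ×ˢ Set.Icc a b, ‖x p.1 - y p.2‖ =
      sInf ((fun p : ℝ × ℝ => ‖x p.1 - y p.2‖) '' (Set.Icc a b ×ˢ Set.Icc a b)) := by
  have hne : (Set.Icc a b ×ˢ Set.Icc a b).Nonempty :=
    (Set.nonempty_Icc.2 hab).prod (Set.nonempty_Icc.2 hab)
  obtain ⟨p, hp, h, -⟩ := (isCompact_Icc.prod isCompact_Icc).exists_sInf_image_eq_and_le hne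
    (f := fun p : ℝ × ℝ => ‖x p.1 - y p.2‖) (by fun_prop)
  exact ⟨p, hp, h.symm⟩

/-- The partition sequence for globally defined continuous functions. -/
lemma exists_strictAnti_sInf_norm_sub_eq {E : Type*} [NormedAddCommGroup E] {x y : ℝ → E}
    (hx : Continuous x) (hy : Continuous y) {t₀ : ℝ} (hne : x t₀ ≠ y t₀) :
    ∃ t : ℕ → ℝ, t 0 = t₀ ∧ StrictAnti t ∧
      (∀ k : ℕ,
        sInf ((fun p : ℝ × ℝ => ‖x p.1 - y p.2‖) ''
            (Set.Icc (t (k + 1)) (t k) ×ˢ Set.Icc (t (k + 1)) (t k))) =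
          t k - t (k + 1)) ∧
      (Filter.Tendsto t Filter.atTop Filter.atBot ∨
        ∃ tinf : ℝ, Filter.Tendsto t Filter.atTop (nhds tinf) ∧ x tinf = y tinf) := by
  have step (u : {u : ℝ // x u ≠ y u}) : ∃ v : {v : ℝ // x v ≠ y v}, v.1 < u.1 ∧
      sInf ((fun p : ℝ × ℝ => ‖x p.1 - y p.2‖) ''
        (Set.Icc v.1 u.1 ×ˢ Set.Icc v.1 u.1)) = u.1 - v.1 := by
    obtain ⟨h, hpos, hh⟩ := exists_pos_sInf_norm_sub_eq hx hy u.2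
    refine ⟨⟨u.1 - h, fun heq => ?_⟩, by simpa using hpos, by simpa using hh⟩
    have hmem : u.1 - h ∈ Set.Icc (u.1 - h) u.1 := Set.left_mem_Icc.2 (by linarith)
    have hle : h ≤ ‖x (u.1 - h) - y (u.1 - h)‖ := by
      conv_lhs => rw [← hh]
      exact csInf_le ⟨0, by rintro _ ⟨p, -, rfl⟩; exact norm_nonneg _⟩
        ⟨(u.1 - h, u.1 - h), ⟨hmem, hmem⟩, rfl⟩
    rw [heq, sub_self, norm_zero] at hle
    linarith
  choose next hlt hinf using step
  let s : ℕ → {u : ℝ // x u ≠ y u} := fun k => next^[k] ⟨t₀, hne⟩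
  have hs (k : ℕ) : s (k + 1) = next (s k) := Function.iterate_succ_apply' _ _ _
  let t : ℕ → ℝ := fun k => (s k).1
  have hanti : StrictAnti t := strictAnti_nat_of_succ_lt fun k => by
    simpa only [t, hs] using hlt (s k)
  have hsInf (k : ℕ) : sInf ((fun p : ℝ × ℝ => ‖x p.1 - y p.2‖) ''
      (Set.Icc (t (k + 1)) (t k) ×ˢ Set.Icc (t (k + 1)) (t k))) = t k - t (k + 1) := by
    simpa only [t, hs] using hinf (s k)
  refine ⟨t, rfl, hanti, hsInf, (tendsto_atTop_of_antitone hanti.antitone).imp_right ?_⟩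
  rintro ⟨l, hl⟩
  refine ⟨l, hl, ?_⟩
  have hl' : Filter.Tendsto (fun k => t (k + 1)) Filter.atTop (nhds l) :=
    hl.comp (Filter.tendsto_add_atTop_nat 1)
  choose p hp hmin using fun k =>
    exists_norm_sub_eq_sInf hx hy (hanti.antitone (Nat.le_succ k))
  have hp₁ : Filter.Tendsto (fun k => (p k).1) Filter.atTop (nhds l) :=
    tendsto_of_tendsto_of_tendsto_of_le_of_le hl' hl (fun k => (hp k).1.1) fun k => (hp k).1.2
  have hp₂ : Filter.Tendsto (fun k => (p k).2) Filter.atTop (nhds l) :=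
    tendsto_of_tendsto_of_tendsto_of_le_of_le hl' hl (fun k => (hp k).2.1) fun k => (hp k).2.2
  have hnorm : Filter.Tendsto (fun k => ‖x (p k).1 - y (p k).2‖) Filter.atTop
      (nhds ‖x l - y l‖) :=
    (((hx.tendsto l).comp hp₁).sub ((hy.tendsto l).comp hp₂)).norm
  have hzero : Filter.Tendsto (fun k => ‖x (p k).1 - y (p k).2‖) Filter.atTop (nhds 0) := by
    simpa only [hmin, Nat.succ_eq_add_one, hsInf, sub_self] using hl.sub hl'
  exact sub_eq_zero.1 (norm_eq_zero.1 (tendsto_nhds_unique hnorm hzero))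


/-- Partition Lemma: given continuous `x, y : (−∞, t₀] → ℝⁿ` with equal limits at
`−∞` and `x(t₀) ≠ y(t₀)`, there is a strictly decreasing sequence `t_k` starting at
`t₀` with `inf{|x(t) − y(s)| : t, s ∈ [t_{k+1}, t_k]} = t_k − t_{k+1}`, and either
`t_k → −∞` or `t_k → t_∞` with `x(t_∞) = y(t_∞)`. -/
theorem stmt7 (n : ℕ) (t₀ : ℝ) (x y : ℝ → EuclideanSpace ℝ (Fin n))
    (hxc : ContinuousOn x (Set.Iic t₀)) (hyc : ContinuousOn y (Set.Iic t₀))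
    (L : EuclideanSpace ℝ (Fin n))
    (hxl : Filter.Tendsto x Filter.atBot (nhds L))
    (hyl : Filter.Tendsto y Filter.atBot (nhds L))
    (hne : x t₀ ≠ y t₀) :
    ∃ t : ℕ → ℝ, t 0 = t₀ ∧ StrictAnti t ∧
      (∀ k : ℕ,
        sInf ((fun p : ℝ × ℝ => ‖x p.1 - y p.2‖) ''
            (Set.Icc (t (k + 1)) (t k) ×ˢ Set.Icc (t (k + 1)) (t k))) =
          t k - t (k + 1)) ∧
      (Filter.Tendsto t Filter.atTop Filter.atBot ∨
        ∃ tinf : ℝ, Filter.Tendsto t Filter.atTop (nhds tinf) ∧ x tinf = y tinf) := by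
  have hcomp {z : ℝ → EuclideanSpace ℝ (Fin n)} (hz : ContinuousOn z (Set.Iic t₀)) :
      Continuous fun r => z (min r t₀) :=
    hz.comp_continuous (by fun_prop) fun r => min_le_right r t₀
  obtain ⟨t, ht₀, hanti, hinf, hlim⟩ :=
    exists_strictAnti_sInf_norm_sub_eq (hcomp hxc) (hcomp hyc) (t₀ := t₀) (by simpa using hne)
  have hle (k : ℕ) : t k ≤ t₀ := ht₀ ▸ hanti.antitone (Nat.zero_le k)
  refine ⟨t, ht₀, hanti, fun k => ?_, hlim.imp_right ?_⟩
  · rw [← hinf k]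
    congr 1
    refine Set.image_congr fun p hp => ?_
    rw [min_eq_left (hp.1.2.trans (hle k)), min_eq_left (hp.2.2.trans (hle k))]
  · rintro ⟨l, hl, heq⟩
    have hl₀ : l ≤ t₀ := le_of_tendsto' hl hle
    exact ⟨l, hl, by simpa only [min_eq_left hl₀] using heq⟩
end

section
/- Let t₁ < t₀ be real numbers and let x, y : [t₁, t₀] → ℝⁿ be continuously differentiable functions such that inf{ |x(t) − y(s)| : t, s ∈ [t₁, t₀] } = t₀ − t₁. Then for every τ ∈ [t₁, t₀], |x(t₀) − y(t₀)| ≤ (1 + C)·|x(τ) − y(τ)|, where C = sup{ |x′(t)| + |y′(t)| : τ ≤ t ≤ t₀ }. -/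
/-- If `x, y` are `C¹` on `[t₁, t₀]` and `inf{|x(t) − y(s)| : t, s ∈ [t₁, t₀]} = t₀ − t₁`,
then for every `τ ∈ [t₁, t₀]`, `|x(t₀) − y(t₀)| ≤ (1 + C)·|x(τ) − y(τ)|` where
`C = sup{|x′(t)| + |y′(t)| : τ ≤ t ≤ t₀}`. -/
theorem stmt8 (n : ℕ) (t₁ t₀ : ℝ) (h : t₁ < t₀)
    (x y x' y' : ℝ → EuclideanSpace ℝ (Fin n))
    (hx : ∀ t ∈ Set.Icc t₁ t₀, HasDerivAt x (x' t) t)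
    (hy : ∀ t ∈ Set.Icc t₁ t₀, HasDerivAt y (y' t) t)
    (hx'c : ContinuousOn x' (Set.Icc t₁ t₀))
    (hy'c : ContinuousOn y' (Set.Icc t₁ t₀))
    (hinf : sInf ((fun p : ℝ × ℝ => ‖x p.1 - y p.2‖) ''
        (Set.Icc t₁ t₀ ×ˢ Set.Icc t₁ t₀)) = t₀ - t₁)
    (τ : ℝ) (hτ : τ ∈ Set.Icc t₁ t₀) :
    ‖x t₀ - y t₀‖ ≤
      (1 + sSup ((fun t => ‖x' t‖ + ‖y' t‖) '' Set.Icc τ t₀)) * ‖x τ - y τ‖ := by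
  have hsub : Set.Icc τ t₀ ⊆ Set.Icc t₁ t₀ := Set.Icc_subset_Icc_left hτ.1
  set C := sSup ((fun t => ‖x' t‖ + ‖y' t‖) '' Set.Icc τ t₀)
  have hbdd : BddAbove ((fun t => ‖x' t‖ + ‖y' t‖) '' Set.Icc τ t₀) :=
    isCompact_Icc.bddAbove_image
      ((hx'c.mono hsub).norm.add (hy'c.mono hsub).norm)
  have hle : ∀ t ∈ Set.Icc τ t₀, ‖x' t‖ + ‖y' t‖ ≤ C := fun t ht =>
    le_csSup hbdd (Set.mem_image_of_mem _ ht)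
  have hC0 : 0 ≤ C :=
    (add_nonneg (norm_nonneg _) (norm_nonneg _)).trans (hle τ (Set.left_mem_Icc.2 hτ.2))
  have hdist : t₀ - t₁ ≤ ‖x τ - y τ‖ := by
    rw [← hinf]
    refine csInf_le ⟨0, ?_⟩ ⟨(τ, τ), ⟨hτ, hτ⟩, rfl⟩
    rintro _ ⟨p, -, rfl⟩
    exact norm_nonneg _
  have hmvt : ‖(x t₀ - y t₀) - (x τ - y τ)‖ ≤ C * (t₀ - τ) :=
    norm_image_sub_le_of_norm_deriv_le_segment' (f := fun t => x t - y t)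
      (f' := fun t => x' t - y' t)
      (fun t ht => ((hx t (hsub ht)).sub (hy t (hsub ht))).hasDerivWithinAt)
      (fun t ht => (norm_sub_le _ _).trans (hle t (Set.Ico_subset_Icc_self ht)))
      t₀ (Set.right_mem_Icc.2 hτ.2)
  have htri := norm_le_norm_add_norm_sub' (x t₀ - y t₀) (x τ - y τ)
  have hmul : C * (t₀ - τ) ≤ C * ‖x τ - y τ‖ :=
    mul_le_mul_of_nonneg_left (by linarith [hτ.1]) hC0
  linarith
end

section
/- Let f : ℂ → ℂ be continuous, δ₀ ∈ (0,1], and let x : [α, β] → ℂ \ {0} be differentiable with x′(t) = f(x(t)) for all t ∈ [α, β]. Suppose that ⟨f(x(t)), x(t)⟩ ≥ δ₀·|f(x(t))|·|x(t)| for all t ∈ [α, β]. Then |x(β) − x(α)| ≤ ∫_α^β |x′(t)| dt ≤ (1/δ₀)·(|x(β)| − |x(α)|). -/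
open scoped RealInnerProductSpace in
theorem HasDerivAt.norm_of_ne_zero {E : Type*} [NormedAddCommGroup E] [InnerProductSpace ℝ E]
    {x : ℝ → E} {x' : E} {t : ℝ} (hx : HasDerivAt x x' t) (h0 : x t ≠ 0) :
    HasDerivAt (fun s => ‖x s‖) (⟪x t, x'⟫ / ‖x t‖) t := by
  have h := hx.norm_sq.sqrt (pow_ne_zero 2 (norm_ne_zero_iff.mpr h0))
  simp only [Real.sqrt_sq (norm_nonneg _)] at h
  convert h using 1
  rw [mul_div_mul_left _ _ two_ne_zero]

/-- Reverse triangle inequality along integral curves of a field satisfying a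
`δ₀`-monotonicity bound with respect to the origin:
`|x(β) − x(α)| ≤ ∫_α^β |x′(t)| dt ≤ (1/δ₀)(|x(β)| − |x(α)|)`. -/
theorem stmt9 (f : ℂ → ℂ) (hf : Continuous f)
    (δ₀ : ℝ) (hδ₀ : δ₀ ∈ Set.Ioc (0 : ℝ) 1)
    (α β : ℝ) (hαβ : α ≤ β) (x : ℝ → ℂ)
    (hx0 : ∀ t ∈ Set.Icc α β, x t ≠ 0)
    (hx : ∀ t ∈ Set.Icc α β, HasDerivAt x (f (x t)) t)
    (hδ : ∀ t ∈ Set.Icc α β,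
      (f (x t) * (starRingEnd ℂ) (x t)).re ≥ δ₀ * ‖f (x t)‖ * ‖x t‖) :
    ‖x β - x α‖ ≤ (∫ t in α..β, ‖f (x t)‖) ∧
      (∫ t in α..β, ‖f (x t)‖) ≤ (1 / δ₀) * (‖x β‖ - ‖x α‖) := by
  have hxc : ContinuousOn x (Set.Icc α β) := fun t ht => (hx t ht).continuousAt.continuousWithinAt
  have hfc : ContinuousOn (fun t => f (x t)) (Set.Icc α β) := hf.comp_continuousOn hxc
  have hfi : IntervalIntegrable (fun t => f (x t)) MeasureTheory.volume α β :=
    hfc.intervalIntegrable_of_Icc hαβ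
  constructor
  · rw [← intervalIntegral.integral_eq_sub_of_hasDerivAt
      (fun t ht => hx t (Set.uIcc_of_le hαβ ▸ ht)) hfi]
    exact intervalIntegral.norm_integral_le_integral_norm hαβ
  · have hdc : ContinuousOn (fun t => inner ℝ (x t) (f (x t)) / ‖x t‖) (Set.Icc α β) :=
      (hxc.inner hfc).div hxc.norm fun t ht => norm_ne_zero_iff.mpr (hx0 t ht)
    have hdi := hdc.intervalIntegrable_of_Icc (μ := MeasureTheory.volume) hαβ
    rw [← intervalIntegral.integral_eq_sub_of_hasDerivAt
      (fun t ht => (hx t (Set.uIcc_of_le hαβ ▸ ht)).norm_of_ne_zero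
        (hx0 t (Set.uIcc_of_le hαβ ▸ ht))) hdi, one_div, ← div_eq_inv_mul, le_div_iff₀' hδ₀.1,
      ← intervalIntegral.integral_const_mul]
    refine intervalIntegral.integral_mono_on hαβ (hfi.norm.const_mul δ₀) hdi fun t ht => ?_
    rw [le_div_iff₀ (norm_pos_iff.mpr (hx0 t ht)), Complex.inner]
    simpa [mul_comm] using hδ t ht
end

section
/- Let f : ℂ → ℂ be continuous, m > 0, and let x : [α, β] → ℂ \ {0} be differentiable with x′(t) = f(x(t)) for all t ∈ [α, β]. Suppose that ⟨f(x(t)), x(t)⟩/|x(t)| ≥ m for all t ∈ [α, β]. Then β − α ≤ (|x(β)| − |x(α)|)/m. -/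
/-- Derivative of the norm along a curve in `ℂ` away from the origin. -/
theorem HasDerivAt.norm_complex {x : ℝ → ℂ} {v : ℂ} {t : ℝ} (hx : HasDerivAt x v t)
    (h0 : x t ≠ 0) :
    HasDerivAt (fun s => ‖x s‖) ((v * (starRingEnd ℂ) (x t)).re / ‖x t‖) t := by
  have h := hx.norm_sq.sqrt (pow_ne_zero 2 (norm_ne_zero_iff.mpr h0))
  simp only [Real.sqrt_sq (norm_nonneg _), Complex.inner] at h
  convert h using 1
  rw [mul_div_mul_left _ _ two_ne_zero]

/-- Finite travel time in an annulus: if `⟨f(x(t)), x(t)⟩/|x(t)| ≥ m` along a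
trajectory of `ẋ = f(x)`, then `β − α ≤ (|x(β)| − |x(α)|)/m`. -/
theorem stmt10 (f : ℂ → ℂ) (hf : Continuous f) (m : ℝ) (hm : 0 < m)
    (α β : ℝ) (hαβ : α ≤ β) (x : ℝ → ℂ)
    (hx0 : ∀ t ∈ Set.Icc α β, x t ≠ 0)
    (hx : ∀ t ∈ Set.Icc α β, HasDerivAt x (f (x t)) t)
    (hlow : ∀ t ∈ Set.Icc α β,
      (f (x t) * (starRingEnd ℂ) (x t)).re / ‖x t‖ ≥ m) :
    β - α ≤ (‖x β‖ - ‖x α‖) / m := by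
  have hd : ∀ t ∈ Set.Icc α β, HasDerivAt (fun s => ‖x s‖)
      ((f (x t) * (starRingEnd ℂ) (x t)).re / ‖x t‖) t :=
    fun t ht => (hx t ht).norm_complex (hx0 t ht)
  have h := (convex_Icc α β).mul_sub_le_image_sub_of_le_deriv
    (fun t ht => (hd t ht).continuousAt.continuousWithinAt)
    (fun t ht => (hd t (interior_subset ht)).differentiableAt.differentiableWithinAt)
    (fun t ht => by
      rw [(hd t (interior_subset ht)).deriv]
      exact hlow t (interior_subset ht))
    α (Set.left_mem_Icc.mpr hαβ) β (Set.right_mem_Icc.mpr hαβ) hαβ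
  rwa [le_div_iff₀ hm, mul_comm]
end

section
/- Let f : ℂ → ℂ be continuous and let x : [α, β] → ℂ be differentiable with x′(t) = f(x(t)) for all t ∈ [α, β] and x(α) ≠ x(β). Set v = (x(β) − x(α))/(β − α) and D = diam f(x([α, β])). Then ⟨f(x(β)) − f(x(α)), (x(β) − x(α))/|x(β) − x(α)|⟩ ≤ |f(x(β))| − |f(x(α))| + D²/(2|v|). -/
/-- The mean value inequality for a solution of an autonomous ODE, compared with the initial
velocity: the displacement differs from `(β - α) • f (x α)` by at most `diam * (β - α)`. -/
theorem norm_sub_sub_smul_le_diam (f : ℂ → ℂ) (hf : Continuous f) (α β : ℝ) (hαβ : α < β)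
    (x : ℝ → ℂ) (hx : ∀ t ∈ Set.Icc α β, HasDerivAt x (f (x t)) t) :
    ‖(x β - x α) - ((β - α : ℝ) : ℂ) * f (x α)‖ ≤
      Metric.diam (f '' (x '' Set.Icc α β)) * (β - α) := by
  have hxc : ContinuousOn x (Set.Icc α β) := fun t ht =>
    (hx t ht).continuousAt.continuousWithinAt
  have hb : Bornology.IsBounded (f '' (x '' Set.Icc α β)) :=
    ((isCompact_Icc.image_of_continuousOn hxc).image hf).isBounded
  have hα : α ∈ Set.Icc α β := Set.left_mem_Icc.2 hαβ.le
  have hderiv : ∀ t ∈ Set.Icc α β,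
      HasDerivWithinAt (fun s : ℝ => x s - (s : ℂ) * f (x α)) (f (x t) - f (x α))
        (Set.Icc α β) t := by
    intro t ht
    have h := (hx t ht).sub ((HasDerivAt.ofReal_comp (hasDerivAt_id t)).mul_const (f (x α)))
    rw [Complex.ofReal_one, one_mul] at h
    exact h.hasDerivWithinAt
  have h := norm_image_sub_le_of_norm_deriv_le_segment' hderiv
    (C := Metric.diam (f '' (x '' Set.Icc α β)))
    (fun t ht => by
      rw [← dist_eq_norm]
      exact Metric.dist_le_diam_of_mem hb
        (Set.mem_image_of_mem f (Set.mem_image_of_mem x (Set.Ico_subset_Icc_self ht)))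
        (Set.mem_image_of_mem f (Set.mem_image_of_mem x hα)))
    β (Set.right_mem_Icc.2 hαβ.le)
  refine (le_of_eq ?_).trans h
  congr 1
  push_cast
  ring

/-- Modulus of monotonicity bound at endpoints of an integral arc:
`⟨f(x(β)) − f(x(α)), (x(β) − x(α))/|x(β) − x(α)|⟩ ≤ |f(x(β))| − |f(x(α))| + D²/(2|v|)`,
where `v = (x(β) − x(α))/(β − α)` and `D = diam f(x([α, β]))`. -/
theorem stmt12 (f : ℂ → ℂ) (hf : Continuous f) (α β : ℝ) (hαβ : α < β)
    (x : ℝ → ℂ) (hx : ∀ t ∈ Set.Icc α β, HasDerivAt x (f (x t)) t)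
    (hne : x α ≠ x β) :
    ((f (x β) - f (x α)) * (starRingEnd ℂ) (x β - x α)).re / ‖x β - x α‖ ≤
      ‖f (x β)‖ - ‖f (x α)‖ +
        (Metric.diam (f '' (x '' Set.Icc α β))) ^ 2 /
          (2 * ‖(x β - x α) / ((β : ℂ) - (α : ℂ))‖) := by
  have hmv := norm_sub_sub_smul_le_diam f hf α β hαβ x hx
  set D := Metric.diam (f '' (x '' Set.Icc α β))
  set a := f (x α)
  set b := f (x β)
  have hw : 0 < ‖x β - x α‖ := norm_pos_iff.2 (sub_ne_zero.2 hne.symm)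
  set w := x β - x α
  have hT : 0 < β - α := sub_pos.2 hαβ
  have hv : ‖w / ((β : ℂ) - (α : ℂ))‖ = ‖w‖ / (β - α) := by
    rw [norm_div, ← Complex.ofReal_sub, Complex.norm_real, Real.norm_of_nonneg hT.le]
  rw [hv]
  generalize β - α = T at *
  have hb : (b * (starRingEnd ℂ) w).re ≤ ‖b‖ * ‖w‖ := by
    simpa using Complex.re_le_norm (b * (starRingEnd ℂ) w)
  have hsq : ‖w - (T : ℂ) * a‖ ^ 2 =
      ‖w‖ ^ 2 - 2 * T * (a * (starRingEnd ℂ) w).re + T ^ 2 * ‖a‖ ^ 2 := by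
    simp only [Complex.sq_norm, Complex.normSq_apply, Complex.sub_re, Complex.sub_im,
      Complex.mul_re, Complex.mul_im, Complex.ofReal_re, Complex.ofReal_im, Complex.conj_re,
      Complex.conj_im]
    ring
  have hle : ‖w - (T : ℂ) * a‖ ^ 2 ≤ (D * T) ^ 2 := pow_le_pow_left₀ (norm_nonneg _) hmv 2
  have ha : 2 * (‖a‖ * ‖w‖ - (a * (starRingEnd ℂ) w).re) ≤ D ^ 2 * T := by
    refine le_of_mul_le_mul_left ?_ hT
    nlinarith [sq_nonneg (‖w‖ - T * ‖a‖)]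
  have hD : D ^ 2 / (2 * (‖w‖ / T)) * ‖w‖ = D ^ 2 * T / 2 := by
    field_simp
  rw [div_le_iff₀ hw, sub_mul, Complex.sub_re, add_mul, hD]
  linarith
end

section
/- Let f : ℂ → ℂ be continuous and let x, y : [α, β] → ℂ be differentiable with x′(t) = f(x(t)) and y′(t) = f(y(t)) for all t ∈ [α, β], and suppose x(t) ≠ y(t) for all t ∈ [α, β]. Then log|x(β) − y(β)| − log|x(α) − y(α)| = ∫_α^β ⟨f(x(t)) − f(y(t)), x(t) − y(t)⟩ / |x(t) − y(t)|² dt. -/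
/-- The derivative of `log ‖z‖` along a curve `z` in a real inner product space. -/
theorem hasDerivAt_log_norm {E : Type*} [NormedAddCommGroup E] [InnerProductSpace ℝ E]
    {z : ℝ → E} {v : E} {t : ℝ} (hz : HasDerivAt z v t) (h0 : z t ≠ 0) :
    HasDerivAt (fun s => Real.log ‖z s‖) (inner ℝ (z t) v / ‖z t‖ ^ 2) t := by
  have hlog := (hz.norm_sq.log (by simpa using h0)).const_mul (1 / 2 : ℝ)
  refine (hlog.congr_deriv (by ring)).congr_of_eventuallyEq (.of_forall fun s => ?_)
  dsimp only
  rw [Real.log_pow]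
  push_cast
  ring

/-- Logarithmic distance identity between two non-colliding trajectories of
`ẋ = f(x)`:
`log|x(β) − y(β)| − log|x(α) − y(α)| = ∫_α^β ⟨f(x) − f(y), x − y⟩ / |x − y|² dt`. -/
theorem stmt13 (f : ℂ → ℂ) (hf : Continuous f) (α β : ℝ) (hαβ : α ≤ β)
    (x y : ℝ → ℂ)
    (hx : ∀ t ∈ Set.Icc α β, HasDerivAt x (f (x t)) t)
    (hy : ∀ t ∈ Set.Icc α β, HasDerivAt y (f (y t)) t)
    (hne : ∀ t ∈ Set.Icc α β, x t ≠ y t) :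
    Real.log ‖x β - y β‖ - Real.log ‖x α - y α‖ =
      ∫ t in α..β,
        ((f (x t) - f (y t)) * (starRingEnd ℂ) (x t - y t)).re / ‖x t - y t‖ ^ 2 := by
  have hxc : ContinuousOn x (Set.Icc α β) :=
    fun t ht => (hx t ht).continuousAt.continuousWithinAt
  have hyc : ContinuousOn y (Set.Icc α β) :=
    fun t ht => (hy t ht).continuousAt.continuousWithinAt
  symm
  apply intervalIntegral.integral_eq_sub_of_hasDerivAt
    (f := fun t => Real.log ‖x t - y t‖)
  · intro t ht
    rw [Set.uIcc_of_le hαβ] at ht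
    have h := hasDerivAt_log_norm ((hx t ht).sub (hy t ht)) (sub_ne_zero.mpr (hne t ht))
    simpa only [Complex.inner, Pi.sub_apply, mul_comm] using h
  · apply ContinuousOn.intervalIntegrable
    rw [Set.uIcc_of_le hαβ]
    refine ContinuousOn.div ?_ ((hxc.sub hyc).norm.pow 2) fun t ht =>
      pow_ne_zero 2 (norm_ne_zero_iff.mpr (sub_ne_zero.mpr (hne t ht)))
    exact Complex.continuous_re.comp_continuousOn
      (((hf.comp_continuousOn hxc).sub (hf.comp_continuousOn hyc)).mul
        (Complex.continuous_conj.comp_continuousOn (hxc.sub hyc)))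
end

section
/- Let z : [α, β] → ℂ be continuously differentiable with |z′(t)| = 1 for all t ∈ [α, β] and |z′(t) − z′(s)| ≤ √2/2 for all t, s ∈ [α, β]. Suppose z(α) = 0 and z(β) = L, where L > 0 is a positive real number. Then for all α ≤ s ≤ t ≤ β: |Im z(t) − Im z(s)| ≤ Re z(t) − Re z(s). In particular, the function t ↦ Re z(t) is nondecreasing and |Im z(t)| ≤ Re z(t) ≤ L for all t ∈ [α, β]. -/
/-- Mean value inequality for a real linear functional of a differentiable complex curve. -/
theorem mul_sub_le_of_le_linear_deriv {α β : ℝ} {z z' : ℝ → ℂ}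
    (hz : ∀ t ∈ Set.Icc α β, HasDerivAt z (z' t) t) (a b m : ℝ)
    (hm : ∀ t ∈ Set.Icc α β, m ≤ a * (z' t).re + b * (z' t).im)
    {s t : ℝ} (hs : α ≤ s) (hst : s ≤ t) (ht : t ≤ β) :
    m * (t - s) ≤ a * ((z t).re - (z s).re) + b * ((z t).im - (z s).im) := by
  have hd : ∀ x ∈ Set.Icc α β, HasDerivAt (fun x => a * (z x).re + b * (z x).im)
      (a * (z' x).re + b * (z' x).im) x := fun x hx =>
    ((Complex.reCLM.hasFDerivAt.comp_hasDerivAt x (hz x hx)).const_mul a).add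
      ((Complex.imCLM.hasFDerivAt.comp_hasDerivAt x (hz x hx)).const_mul b)
  have key := (convex_Icc α β).mul_sub_le_image_sub_of_le_deriv
    (fun x hx => (hd x hx).continuousAt.continuousWithinAt)
    (fun x hx => (hd x (interior_subset hx)).differentiableAt.differentiableWithinAt)
    (C := m)
    (fun x hx => by rw [(hd x (interior_subset hx)).deriv]; exact hm x (interior_subset hx))
    s ⟨hs, hst.trans ht⟩ t ⟨hs.trans hst, ht⟩ hst
  linarith

/-- A short `C¹` arc parametrized by arc length whose tangent oscillates by at most
`√2/2`, placed with endpoints `0` and `L > 0` on the real axis, is a graph: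
`|Im z(t) − Im z(s)| ≤ Re z(t) − Re z(s)` for `s ≤ t`; in particular `Re z` is
nondecreasing and `|Im z(t)| ≤ Re z(t) ≤ L`. -/
theorem stmt14 (α β : ℝ) (hαβ : α ≤ β) (z z' : ℝ → ℂ)
    (hz : ∀ t ∈ Set.Icc α β, HasDerivAt z (z' t) t)
    (hz'c : ContinuousOn z' (Set.Icc α β))
    (hunit : ∀ t ∈ Set.Icc α β, ‖z' t‖ = 1)
    (hosc : ∀ t ∈ Set.Icc α β, ∀ s ∈ Set.Icc α β, ‖z' t - z' s‖ ≤ Real.sqrt 2 / 2)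
    (L : ℝ) (hL : 0 < L) (hzα : z α = 0) (hzβ : z β = (L : ℂ)) :
    (∀ s t : ℝ, α ≤ s → s ≤ t → t ≤ β →
        |(z t).im - (z s).im| ≤ (z t).re - (z s).re) ∧
      MonotoneOn (fun t => (z t).re) (Set.Icc α β) ∧
      (∀ t ∈ Set.Icc α β, |(z t).im| ≤ (z t).re ∧ (z t).re ≤ L) := by
  have hsq : ∀ t ∈ Set.Icc α β, (z' t).re ^ 2 + (z' t).im ^ 2 = 1 := by
    intro t ht
    have h := Complex.sq_norm (z' t)
    rw [hunit t ht, Complex.normSq_apply] at h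
    linarith
  have hdot : ∀ t ∈ Set.Icc α β, ∀ s ∈ Set.Icc α β,
      3 / 4 ≤ (z' t).re * (z' s).re + (z' t).im * (z' s).im := by
    intro t ht s hs
    have h := Complex.sq_norm (z' t - z' s)
    have h2 : ‖z' t - z' s‖ ^ 2 ≤ (Real.sqrt 2 / 2) ^ 2 :=
      pow_le_pow_left₀ (norm_nonneg _) (hosc t ht s hs) 2
    rw [div_pow, Real.sq_sqrt zero_le_two] at h2
    rw [Complex.normSq_apply, Complex.sub_re, Complex.sub_im] at h
    linarith [hsq t ht, hsq s hs]
  have hlen : L ≤ β - α := by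
    have h := mul_sub_le_of_le_linear_deriv hz (-1) 0 (-1)
      (fun t ht => by nlinarith [hsq t ht, sq_nonneg (z' t).im]) le_rfl hαβ le_rfl
    simp only [hzα, hzβ, Complex.ofReal_re, Complex.zero_re] at h
    linarith
  have hre : ∀ t ∈ Set.Icc α β, 3 / 4 ≤ (z' t).re := by
    intro t ht
    have h := mul_sub_le_of_le_linear_deriv hz _ _ _ (hdot t ht) le_rfl hαβ le_rfl
    simp only [hzα, hzβ, Complex.ofReal_re, Complex.zero_re, Complex.ofReal_im,
      Complex.zero_im] at h
    refine le_of_mul_le_mul_right ?_ hL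
    linarith
  have him : ∀ t ∈ Set.Icc α β, |(z' t).im| ≤ (z' t).re := by
    intro t ht
    refine abs_le_of_sq_le_sq ?_ (by linarith [hre t ht])
    nlinarith [hsq t ht, hre t ht]
  have main : ∀ s t : ℝ, α ≤ s → s ≤ t → t ≤ β →
      |(z t).im - (z s).im| ≤ (z t).re - (z s).re := by
    intro s t hs hst ht
    have h₁ := mul_sub_le_of_le_linear_deriv hz 1 1 0
      (fun t ht => by linarith [(abs_le.mp (him t ht)).1]) hs hst ht
    have h₂ := mul_sub_le_of_le_linear_deriv hz 1 (-1) 0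
      (fun t ht => by linarith [(abs_le.mp (him t ht)).2]) hs hst ht
    exact abs_le.mpr ⟨by linarith, by linarith⟩
  have mono : MonotoneOn (fun t => (z t).re) (Set.Icc α β) := fun s hs t ht hst =>
    sub_nonneg.mp ((abs_nonneg _).trans (main s t hs.1 hst ht.2))
  refine ⟨main, mono, fun t ht => ⟨?_, ?_⟩⟩
  · simpa [hzα] using main α t le_rfl ht.1 ht.2
  · simpa [hzβ] using mono ht ⟨hαβ, le_rfl⟩ ht.2
end

section
/- Let f : ℂ → ℂ be continuous with f(0) = 0 and f(z) ≠ 0 for all z ≠ 0. Suppose that for all 0 < r ≤ R < ∞ there exist constants δ₀ = δ₀(r, R) ∈ (0,1] and m = m(r, R) > 0 such that ⟨f(z), z⟩ ≥ δ₀·|f(z)|·|z| and ⟨f(z), z⟩/|z| ≥ m whenever r ≤ |z| ≤ R. Let x : (α, β) → ℂ \ {0} (with −∞ ≤ α < β ≤ ∞) be differentiable with x′(t) = f(x(t)) for all t ∈ (α, β), and suppose x is maximal: there is no differentiable x̃ : (α′, β′) → ℂ \ {0} with x̃′(t) = f(x̃(t)) for all t ∈ (α′, β′), (α′, β′) strictly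 containing (α, β), and x̃ = x on (α, β). Then lim_{t→α⁺} x(t) = 0 and lim_{t→β⁻} |x(t)| = ∞. -/
open Filter Topology Set

/-- The `k`-th node of Euler's method with step `h` for the vector field `g`, starting at `z`. -/
def eulerNode {E : Type*} [AddCommGroup E] [Module ℝ E] (g : E → E) (h : ℝ) (z : E) : ℕ → E
  | 0 => z
  | k + 1 => eulerNode g h z k + h • g (eulerNode g h z k)

section Peano

variable {E : Type*} [NormedAddCommGroup E] [NormedSpace ℝ E]

lemma norm_eulerNode_sub_le {g : E → E} {h : ℝ} (hh : 0 ≤ h) {z v : E} {ε : ℝ} (k i : ℕ)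
    (hv : ∀ j < i, ‖g (eulerNode g h z (k + j)) - v‖ ≤ ε) :
    ‖eulerNode g h z (k + i) - eulerNode g h z k - (i * h) • v‖ ≤ ε * (i * h) := by
  induction i with
  | zero => simp
  | succ i ih =>
    have h1 := ih fun j hj => hv j (by omega)
    have h2 : ‖h • (g (eulerNode g h z (k + i)) - v)‖ ≤ h * ε := by
      rw [norm_smul, Real.norm_of_nonneg hh]
      exact mul_le_mul_of_nonneg_left (hv i (by omega)) hh
    have h3 : eulerNode g h z (k + (i + 1)) - eulerNode g h z k - ((i + 1 : ℕ) * h) • v =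
        (eulerNode g h z (k + i) - eulerNode g h z k - (i * h) • v) +
          h • (g (eulerNode g h z (k + i)) - v) := by
      rw [← add_assoc, eulerNode]
      push_cast
      module
    rw [h3]
    refine (norm_add_le _ _).trans ?_
    push_cast
    linarith

lemma norm_eulerNode_sub_le_of_bound {g : E → E} {M : ℝ} (hM : ∀ w, ‖g w‖ ≤ M) {h : ℝ}
    (hh : 0 ≤ h) (z : E) (k i : ℕ) :
    ‖eulerNode g h z (k + i) - eulerNode g h z k‖ ≤ M * (i * h) := by
  simpa using norm_eulerNode_sub_le (g := g) (z := z) (v := 0) (ε := M) hh k i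
    fun j _ => by simpa using hM _

/-- **Peano's theorem** for a bounded continuous vector field, forward in time. -/
theorem exists_hasDerivWithinAt_Ici_of_bounded [ProperSpace E] {g : E → E} (hg : Continuous g)
    {M : ℝ} (hM : ∀ w, ‖g w‖ ≤ M) (z : E) :
    ∃ y : ℝ → E, y 0 = z ∧ ∀ t, 0 ≤ t → HasDerivWithinAt y (g (y t)) (Ici 0) t := by
  have hM0 : 0 ≤ M := (norm_nonneg _).trans (hM z)
  let X : ℕ → ℝ → E := fun n t => eulerNode g (n : ℝ)⁻¹ z ⌊t * n⌋₊
  let U : Ultrafilter ℕ := Ultrafilter.of atTop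
  have hU : (U : Filter ℕ) ≤ atTop := Ultrafilter.of_le _
  have hfloor : ∀ t : ℝ, 0 ≤ t →
      Tendsto (fun n : ℕ => (⌊t * n⌋₊ : ℝ) * (n : ℝ)⁻¹) U (𝓝 t) := fun t ht => by
    simpa [div_eq_mul_inv, Function.comp_def] using
      ((tendsto_nat_floor_mul_div_atTop ht).comp tendsto_natCast_atTop_atTop).mono_left hU
  have hlim : ∀ t : ℝ, ∃ w, Tendsto (X · t) U (𝓝 w) := by
    intro t
    have hb : ∀ n, X n t ∈ Metric.closedBall z (M * max t 0) := by
      intro n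
      rw [mem_closedBall_iff_norm]
      have h1 := norm_eulerNode_sub_le_of_bound hM (h := (n : ℝ)⁻¹) (by positivity) z 0 ⌊t * n⌋₊
      rw [zero_add, eulerNode] at h1
      refine h1.trans (mul_le_mul_of_nonneg_left ?_ hM0)
      rcases le_or_gt t 0 with ht | ht
      · rw [Nat.floor_of_nonpos (mul_nonpos_of_nonpos_of_nonneg ht (by positivity))]
        simp
      · rcases n.eq_zero_or_pos with rfl | hn
        · simp
        · have hn' : (0 : ℝ) < n := by exact_mod_cast hn
          rw [← div_eq_mul_inv, div_le_iff₀ hn']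
          exact (Nat.floor_le (by positivity)).trans
            (mul_le_mul_of_nonneg_right (le_max_left _ _) hn'.le)
    obtain ⟨w, -, hw⟩ := (isCompact_closedBall z (M * max t 0)).ultrafilter_le_nhds'
      (U.map (X · t)) (Ultrafilter.mem_map.2 (Filter.Eventually.of_forall hb))
    exact ⟨w, hw⟩
  choose y hy using hlim
  have key : ∀ s t v ε ρ, 0 ≤ s → s ≤ t → M * (t - s) < ρ →
      (∀ w, ‖w - y s‖ < ρ → ‖g w - v‖ ≤ ε) → ‖y t - y s - (t - s) • v‖ ≤ ε * (t - s) := by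
    intro s t v ε ρ hs hst hρ hv
    have hd : Tendsto (fun n : ℕ => ((⌊t * n⌋₊ - ⌊s * n⌋₊ : ℕ) : ℝ) * (n : ℝ)⁻¹) U
        (𝓝 (t - s)) := by
      refine ((hfloor t (hs.trans hst)).sub (hfloor s hs)).congr fun n => ?_
      rw [Nat.cast_sub (Nat.floor_mono (by gcongr)), sub_mul]
    have hnear : Tendsto (fun n : ℕ => ‖X n s - y s‖ +
        M * (((⌊t * n⌋₊ - ⌊s * n⌋₊ : ℕ) : ℝ) * (n : ℝ)⁻¹)) U (𝓝 (0 + M * (t - s))) :=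
      (tendsto_iff_norm_sub_tendsto_zero.1 (hy s)).add (hd.const_mul M)
    rw [zero_add] at hnear
    refine le_of_tendsto_of_tendsto (((hy t).sub (hy s)).sub (hd.smul_const v)).norm
      (hd.const_mul ε) ?_
    filter_upwards [hnear.eventually_lt_const hρ] with n hn
    have hle : ⌊s * n⌋₊ ≤ ⌊t * n⌋₊ := Nat.floor_mono (by gcongr)
    have h1 := norm_eulerNode_sub_le (g := g) (h := (n : ℝ)⁻¹) (by positivity) (z := z) (v := v)
      (ε := ε) ⌊s * n⌋₊ (⌊t * n⌋₊ - ⌊s * n⌋₊) fun j hj => hv _ ?_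
    · rwa [Nat.add_sub_cancel' hle] at h1
    · have h2 := norm_eulerNode_sub_le_of_bound hM (h := (n : ℝ)⁻¹) (by positivity) z ⌊s * n⌋₊ j
      have h3 : M * (j * (n : ℝ)⁻¹) ≤
          M * (((⌊t * n⌋₊ - ⌊s * n⌋₊ : ℕ) : ℝ) * (n : ℝ)⁻¹) := by gcongr
      refine lt_of_le_of_lt ?_ hn
      refine (norm_sub_le_norm_sub_add_norm_sub _ (X n s) _).trans ?_
      linarith
  have hlip : ∀ s t, 0 ≤ s → s ≤ t → ‖y t - y s‖ ≤ M * (t - s) := fun s t hs hst => by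
    simpa using key s t 0 M (M * (t - s) + 1) hs hst (by linarith) fun w _ => by simpa using hM w
  refine ⟨y, tendsto_nhds_unique (hy 0) ?_, fun t ht => ?_⟩
  · simp [X, eulerNode]
  · rw [hasDerivWithinAt_iff_isLittleO, Asymptotics.isLittleO_iff]
    intro ε hε
    obtain ⟨ρ, hρ, hgρ⟩ := Metric.continuous_iff.1 hg (y t) ε hε
    have hv : ∀ w, ‖w - y t‖ < ρ → ‖g w - g (y t)‖ ≤ ε := fun w hw => by
      rw [← dist_eq_norm] at hw ⊢
      exact (hgρ w hw).le
    have hnear : ∀ᶠ s in 𝓝[Ici 0] t, M * |s - t| < ρ / 2 := by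
      apply nhdsWithin_le_nhds
      have : Tendsto (fun s => M * |s - t|) (𝓝 t) (𝓝 (M * |t - t|)) :=
        Continuous.tendsto (by fun_prop) t
      exact this.eventually_lt_const (by simpa using hρ)
    filter_upwards [hnear, self_mem_nhdsWithin] with s hs hs0
    rcases le_total t s with hts | hts
    · rw [abs_of_nonneg (by linarith)] at hs
      rw [Real.norm_of_nonneg (by linarith)]
      exact key t s _ ε ρ ht hts (by linarith) hv
    · rw [abs_of_nonpos (by linarith)] at hs
      rw [Real.norm_of_nonpos (by linarith)]
      have h1 := key s t (g (y t)) ε (ρ / 2) hs0 hts (by linarith) fun w hw => hv w ?_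
      · have h2 : y s - y t - (s - t) • g (y t) = -(y t - y s - (t - s) • g (y t)) := by module
        rwa [h2, norm_neg, neg_sub s t]
      · have h2 := hlip s t hs0 hts
        refine (norm_sub_le_norm_sub_add_norm_sub _ (y s) _).trans_lt ?_
        rw [norm_sub_rev (y s)]
        linarith

/-- **Peano's theorem**, forward in time. -/
theorem exists_hasDerivWithinAt_Ici [ProperSpace E] {f : E → E} (hf : Continuous f) (z : E) :
    ∃ y : ℝ → E, y 0 = z ∧ ∃ η > 0, ∀ t ∈ Ico 0 η, HasDerivWithinAt y (f (y t)) (Ici 0) t := by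
  let c : E → ℝ := fun w => max 0 (min 1 (2 - ‖w - z‖))
  have hg : Continuous fun w => c w • f w := by fun_prop
  obtain ⟨M, hM⟩ := (isCompact_closedBall z 2).exists_bound_of_continuousOn hg.continuousOn
  have hM' : ∀ w, ‖c w • f w‖ ≤ M := by
    intro w
    by_cases hw : w ∈ Metric.closedBall z 2
    · exact hM w hw
    · rw [mem_closedBall_iff_norm, not_le] at hw
      have hc : c w = 0 := max_eq_left (min_le_of_right_le (by linarith))
      rw [hc, zero_smul, norm_zero]
      exact (norm_nonneg _).trans (hM z (by simp))
  obtain ⟨y, hy0, hy⟩ := exists_hasDerivWithinAt_Ici_of_bounded hg hM' z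
  have hnear : ∀ᶠ t in 𝓝[≥] 0, ‖y t - z‖ < 1 := by
    have h1 := (hy 0 le_rfl).continuousWithinAt.sub_const z |>.norm
    exact Tendsto.eventually_lt_const (by simp [hy0]) h1
  obtain ⟨η, hη, hsub⟩ := mem_nhdsGE_iff_exists_Ico_subset.1 hnear
  refine ⟨y, hy0, η, hη, fun t ht => ?_⟩
  have h2 : ‖y t - z‖ < 1 := hsub ht
  have hc : c (y t) = 1 := by
    simp only [c]
    rw [min_eq_left (by linarith), max_eq_right zero_le_one]
  simpa [hc] using hy t ht.1

end Peano

section Extension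

/-- A solution that stays in a compact annulus up to the finite time `b` extends past `b`. -/
theorem exists_extension_right {f : ℂ → ℂ} (hf : Continuous f) {x : ℝ → ℂ} {a b : ℝ} (hab : a < b)
    (hx : ∀ t ∈ Ioo a b, HasDerivAt x (f (x t)) t) {r R : ℝ} (hr : 0 < r)
    (hrx : ∀ t ∈ Ioo a b, r ≤ ‖x t‖) (hxR : ∀ t ∈ Ioo a b, ‖x t‖ ≤ R) :
    ∃ y : ℝ → ℂ, ∃ η > 0, (∀ t < b, y t = x t) ∧
      ∀ t ∈ Ico b (b + η), y t ≠ 0 ∧ HasDerivAt y (f (y t)) t := by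
  have hI : Ioo a b ∈ 𝓝[<] b := Ioo_mem_nhdsLT hab
  obtain ⟨z, hz⟩ : ∃ z, Tendsto x (𝓝[<] b) (𝓝 z) := by
    obtain ⟨C, hC⟩ := (isCompact_closedBall (0 : ℂ) R).exists_bound_of_continuousOn hf.continuousOn
    have hlip : LipschitzOnWith C.toNNReal x (Ioo a b) := by
      refine (convex_Ioo a b).lipschitzOnWith_of_nnnorm_hasDerivWithin_le
        (fun t ht => (hx t ht).hasDerivWithinAt) fun t ht => ?_
      rw [← NNReal.coe_le_coe, coe_nnnorm]
      exact (hC _ (mem_closedBall_zero_iff.2 (hxR t ht))).trans (Real.le_coe_toNNReal C)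
    obtain ⟨X, hX, hXx⟩ := hlip.extend_finite_dimension
    refine ⟨X b, ((hX.continuous.tendsto b).mono_left nhdsWithin_le_nhds).congr' ?_⟩
    filter_upwards [hI] with t ht using (hXx ht).symm
  have hz0 : z ≠ 0 := norm_pos_iff.1 <| hr.trans_le <|
    ge_of_tendsto hz.norm (by filter_upwards [hI] with t ht using hrx t ht)
  obtain ⟨w, hw0, η, hη, hw⟩ := exists_hasDerivWithinAt_Ici hf z
  let y : ℝ → ℂ := fun t => if t < b then x t else w (t - b)
  have hyx : ∀ t < b, y t = x t := fun t ht => if_pos ht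
  have hyw : ∀ t, b ≤ t → y t = w (t - b) := fun t ht => if_neg ht.not_gt
  have hyb : y b = z := by rw [hyw b le_rfl, sub_self, hw0]
  have hright : ∀ t ∈ Ico b (b + η), HasDerivWithinAt y (f (y t)) (Ici b) t := by
    intro t ht
    have h1 := hw (t - b) ⟨by linarith [ht.1], by linarith [ht.2]⟩
    have h2 : HasDerivWithinAt (fun t => w (t - b)) (f (w (t - b))) (Ici b) t := by
      simpa [Function.comp_def] using h1.scomp t ((hasDerivWithinAt_id t (Ici b)).sub_const b)
        fun s hs => by simpa using hs
    rw [hyw t ht.1]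
    exact h2.congr (fun s hs => hyw s hs) (hyw t ht.1)
  have hyx' : y =ᶠ[𝓝[<] b] x := by
    filter_upwards [self_mem_nhdsWithin] with t ht using hyx t ht
  have hyI : ∀ t ∈ Ioo a b, HasDerivAt y (f (y t)) t := fun t ht => by
    rw [hyx t ht.2]
    exact (hx t ht).congr_of_eventuallyEq <| by
      filter_upwards [Iio_mem_nhds ht.2] with s hs using hyx s hs
  have hycont : Tendsto y (𝓝[<] b) (𝓝 (y b)) := by
    rw [hyb]
    exact hz.congr' hyx'.symm
  have hleft : HasDerivWithinAt y (f (y b)) (Iic b) b := by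
    refine hasDerivWithinAt_Iic_of_tendsto_deriv
      (fun t ht => (hyI t ht).differentiableAt.differentiableWithinAt)
      (hycont.mono_left (nhdsWithin_mono _ Ioo_subset_Iio_self)) hI ?_
    refine ((hf.tendsto (y b)).comp hycont).congr' ?_
    filter_upwards [hI] with t ht using (hyI t ht).deriv.symm
  have hder : ∀ t ∈ Ico b (b + η), HasDerivAt y (f (y t)) t := by
    intro t ht
    rcases ht.1.eq_or_lt with rfl | hbt
    · simpa using hleft.union (hright b ht)
    · exact (hright t ht).hasDerivAt (Ici_mem_nhds hbt)
  have hne : ∀ᶠ t in 𝓝[≥] b, y t ≠ 0 := nhdsWithin_le_nhds <|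
    (hder b ⟨le_rfl, by linarith⟩).continuousAt.eventually_ne (by rwa [hyb])
  obtain ⟨c, hc, hsub⟩ := mem_nhdsGE_iff_exists_Ico_subset.1 hne
  refine ⟨y, min η (c - b), lt_min hη (sub_pos.2 hc), hyx, fun t ht => ⟨hsub ⟨ht.1, ?_⟩,
    hder t ⟨ht.1, ?_⟩⟩⟩
  · linarith [ht.2, min_le_right η (c - b)]
  · linarith [ht.2, min_le_left η (c - b)]

/-- A solution that stays in a compact annulus down to the finite time `a` extends before `a`. -/
theorem exists_extension_left {f : ℂ → ℂ} (hf : Continuous f) {x : ℝ → ℂ} {a b : ℝ} (hab : a < b)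
    (hx : ∀ t ∈ Ioo a b, HasDerivAt x (f (x t)) t) {r R : ℝ} (hr : 0 < r)
    (hrx : ∀ t ∈ Ioo a b, r ≤ ‖x t‖) (hxR : ∀ t ∈ Ioo a b, ‖x t‖ ≤ R) :
    ∃ y : ℝ → ℂ, ∃ η > 0, (∀ t, a < t → y t = x t) ∧
      ∀ t ∈ Ioc (a - η) a, y t ≠ 0 ∧ HasDerivAt y (f (y t)) t := by
  have hmem : ∀ t ∈ Ioo (-b) (-a), -t ∈ Ioo a b := fun t ht =>
    ⟨by linarith [ht.2], by linarith [ht.1]⟩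
  obtain ⟨y, η, hη, hyx, hy⟩ := exists_extension_right (f := fun z => -f z) (x := fun t => x (-t))
    hf.neg (neg_lt_neg hab)
    (fun t ht => by simpa [Function.comp_def] using (hx (-t) (hmem t ht)).scomp t (hasDerivAt_neg t))
    hr (fun t ht => hrx _ (hmem t ht)) (fun t ht => hxR _ (hmem t ht))
  refine ⟨fun t => y (-t), η, hη, fun t ht => by simpa using hyx (-t) (neg_lt_neg ht),
    fun t ht => ?_⟩
  obtain ⟨h0, h1⟩ := hy (-t) ⟨by linarith [ht.2], by linarith [ht.1]⟩
  exact ⟨h0, by simpa [Function.comp_def] using h1.scomp t (hasDerivAt_neg t)⟩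

end Extension

/-- Maximal trajectories of a field with `f(0) = 0` as its only critical point,
satisfying uniform `δ₀`-monotonicity and lower radial-speed bounds on each annulus,
emanate from the origin and escape to infinity:
`x(t) → 0` as `t → α⁺` and `|x(t)| → ∞` as `t → β⁻`. -/
theorem stmt15 (f : ℂ → ℂ) (hf : Continuous f) (hf0 : f 0 = 0)
    (hfne : ∀ z : ℂ, z ≠ 0 → f z ≠ 0)
    (hbounds : ∀ r R : ℝ, 0 < r → r ≤ R →
      ∃ δ₀ ∈ Set.Ioc (0 : ℝ) 1, ∃ m > (0 : ℝ), ∀ z : ℂ, r ≤ ‖z‖ → ‖z‖ ≤ R →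
        (f z * (starRingEnd ℂ) z).re ≥ δ₀ * ‖f z‖ * ‖z‖ ∧
          (f z * (starRingEnd ℂ) z).re / ‖z‖ ≥ m)
    (α β : EReal) (hαβ : α < β) (x : ℝ → ℂ)
    (hx0 : ∀ t : ℝ, α < (t : EReal) → (t : EReal) < β → x t ≠ 0)
    (hx : ∀ t : ℝ, α < (t : EReal) → (t : EReal) < β → HasDerivAt x (f (x t)) t)
    (hmax : ¬ ∃ (α' β' : EReal) (x' : ℝ → ℂ), α' ≤ α ∧ β ≤ β' ∧ (α' < α ∨ β < β') ∧
      (∀ t : ℝ, α' < (t : EReal) → (t : EReal) < β' →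
        x' t ≠ 0 ∧ HasDerivAt x' (f (x' t)) t) ∧
      (∀ t : ℝ, α < (t : EReal) → (t : EReal) < β → x' t = x t)) :
    Filter.Tendsto x (Filter.comap Real.toEReal (nhdsWithin α (Set.Ioi α))) (nhds 0) ∧
      Filter.Tendsto (fun t => ‖x t‖)
        (Filter.comap Real.toEReal (nhdsWithin β (Set.Iio β))) Filter.atTop := by
  let s : Set ℝ := {t | α < (t : EReal) ∧ (t : EReal) < β}
  have hs : ∀ t₁ ∈ s, ∀ t₂ ∈ s, Icc t₁ t₂ ⊆ s := fun t₁ h₁ t₂ h₂ t ht =>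
    ⟨h₁.1.trans_le (EReal.coe_le_coe_iff.2 ht.1), (EReal.coe_le_coe_iff.2 ht.2).trans_lt h₂.2⟩
  obtain ⟨t₀, hαt₀, ht₀β⟩ := EReal.lt_iff_exists_real_btwn.1 hαβ
  have ht₀ : t₀ ∈ s := ⟨hαt₀, ht₀β⟩
  have hN : ∀ t ∈ s, HasDerivAt (‖x ·‖ ^ 2) (2 * (f (x t) * (starRingEnd ℂ) (x t)).re) t :=
    fun t ht => by simpa [Complex.inner] using (hx t ht.1 ht.2).norm_sq
  have hlow : ∀ r R : ℝ, 0 < r → r ≤ R → ∃ c > 0, ∀ z : ℂ, r ≤ ‖z‖ → ‖z‖ ≤ R →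
      c ≤ 2 * (f z * (starRingEnd ℂ) z).re := by
    intro r R hr hrR
    obtain ⟨_, _, m, hm, h⟩ := hbounds r R hr hrR
    refine ⟨m * r, mul_pos hm hr, fun z hz hzR => ?_⟩
    have h1 := (le_div_iff₀ (hr.trans_le hz)).1 (h z hz hzR).2
    have h2 := mul_le_mul_of_nonneg_left hz hm.le
    linarith [mul_pos hm hr]
  have hmvt : ∀ c : ℝ, ∀ t₁ ∈ s, ∀ t₂ ∈ s, t₁ ≤ t₂ →
      (∀ t ∈ Icc t₁ t₂, c ≤ 2 * (f (x t) * (starRingEnd ℂ) (x t)).re) →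
      c * (t₂ - t₁) ≤ ‖x t₂‖ ^ 2 - ‖x t₁‖ ^ 2 := by
    intro c t₁ h₁ t₂ h₂ h₁₂ hc
    have hd := fun t ht => hN t (hs t₁ h₁ t₂ h₂ ht)
    refine (convex_Icc t₁ t₂).mul_sub_le_image_sub_of_le_deriv (f := (‖x ·‖ ^ 2))
      (fun t ht => (hd t ht).continuousAt.continuousWithinAt)
      (fun t ht => (hd t (interior_subset ht)).differentiableAt.differentiableWithinAt)
      (fun t ht => ?_) t₁ (left_mem_Icc.2 h₁₂) t₂ (right_mem_Icc.2 h₁₂) h₁₂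
    rw [(hd t (interior_subset ht)).deriv]
    exact hc t (interior_subset ht)
  have hmono : ∀ t₁ ∈ s, ∀ t₂ ∈ s, t₁ ≤ t₂ → ‖x t₁‖ ≤ ‖x t₂‖ := by
    intro t₁ h₁ t₂ h₂ h₁₂
    have h := hmvt 0 t₁ h₁ t₂ h₂ h₁₂ fun t ht => by
      have hts := hs t₁ h₁ t₂ h₂ ht
      obtain ⟨c, hc, h⟩ := hlow _ _ (norm_pos_iff.2 (hx0 t hts.1 hts.2)) le_rfl
      exact hc.le.trans (h _ le_rfl le_rfl)
    exact le_of_sq_le_sq (by linarith) (norm_nonneg _)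
  have hspeed : ∀ r R : ℝ, 0 < r → r ≤ R → ∃ c > 0, ∀ t₁ ∈ s, ∀ t₂ ∈ s, t₁ ≤ t₂ →
      r ≤ ‖x t₁‖ → ‖x t₂‖ ≤ R → c * (t₂ - t₁) ≤ R ^ 2 := by
    intro r R hr hrR
    obtain ⟨c, hc, h⟩ := hlow r R hr hrR
    refine ⟨c, hc, fun t₁ h₁ t₂ h₂ h₁₂ hr₁ hR₂ => ?_⟩
    have h3 := hmvt c t₁ h₁ t₂ h₂ h₁₂ fun t ht =>
      have hts := hs t₁ h₁ t₂ h₂ ht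
      h _ (hr₁.trans (hmono t₁ h₁ t hts ht.1)) ((hmono t hts t₂ h₂ ht.2).trans hR₂)
    have h4 := pow_le_pow_left₀ (norm_nonneg _) hR₂ 2
    linarith [sq_nonneg ‖x t₁‖]
  have hr₀ : 0 < ‖x t₀‖ := norm_pos_iff.2 (hx0 t₀ hαt₀ ht₀β)
  constructor
  · rw [tendsto_zero_iff_norm_tendsto_zero, Metric.tendsto_nhds]
    intro r hr
    suffices h : ∃ t₁ ∈ s, ‖x t₁‖ < r by
      obtain ⟨t₁, h₁, hlt⟩ := h
      filter_upwards [preimage_mem_comap (Ioo_mem_nhdsGT h₁.1)] with t ht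
      rw [dist_zero_right, norm_norm]
      exact (hmono t ⟨ht.1, ht.2.trans h₁.2⟩ t₁ h₁ (EReal.coe_lt_coe_iff.1 ht.2).le).trans_lt hlt
    by_contra! hall
    obtain ⟨c, hc, hcs⟩ := hspeed r ‖x t₀‖ hr (hall t₀ ht₀)
    have hα : ((t₀ - ‖x t₀‖ ^ 2 / c : ℝ) : EReal) ≤ α := by
      by_contra! hlt
      obtain ⟨u, hαu, hu⟩ := EReal.lt_iff_exists_real_btwn.1 hlt
      rw [EReal.coe_lt_coe_iff] at hu
      have hut : u ≤ t₀ := hu.le.trans (sub_le_self _ (by positivity))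
      have hus : u ∈ s := ⟨hαu, (EReal.coe_le_coe_iff.2 hut).trans_lt ht₀β⟩
      have h1 := hcs u hus t₀ ht₀ hut (hall u hus) le_rfl
      have h2 : t₀ - u ≤ ‖x t₀‖ ^ 2 / c := (le_div_iff₀' hc).2 h1
      linarith
    lift α to ℝ using ⟨(hαt₀.trans_le le_top).ne, ((EReal.bot_lt_coe _).trans_le hα).ne'⟩
    have hat₀ : α < t₀ := EReal.coe_lt_coe_iff.1 hαt₀
    have hsub : ∀ t ∈ Ioo α t₀, t ∈ s := fun t ht =>
      ⟨EReal.coe_lt_coe_iff.2 ht.1, (EReal.coe_lt_coe_iff.2 ht.2).trans ht₀β⟩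
    obtain ⟨y, η, hη, hyx, hy⟩ := exists_extension_left hf hat₀
      (fun t ht => hx t (hsub t ht).1 (hsub t ht).2) hr (fun t ht => hall t (hsub t ht))
      (fun t ht => hmono t (hsub t ht) t₀ ht₀ ht.2.le)
    have hlt : ((α - η : ℝ) : EReal) < α := EReal.coe_lt_coe_iff.2 (by linarith)
    refine hmax ⟨(α - η : ℝ), β, y, hlt.le, le_rfl, .inl hlt, fun t h1 h2 => ?_,
      fun t h1 _ => hyx t (EReal.coe_lt_coe_iff.1 h1)⟩
    rcases le_or_gt t α with hta | hta
    · exact hy t ⟨EReal.coe_lt_coe_iff.1 h1, hta⟩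
    · have hta' := EReal.coe_lt_coe_iff.2 hta
      rw [hyx t hta]
      refine ⟨hx0 t hta' h2, (hx t hta' h2).congr_of_eventuallyEq ?_⟩
      filter_upwards [Ioi_mem_nhds hta] with u hu using hyx u hu
  · rw [tendsto_atTop]
    intro R
    suffices h : ∃ t₁ ∈ s, R ≤ ‖x t₁‖ by
      obtain ⟨t₁, h₁, hle⟩ := h
      filter_upwards [preimage_mem_comap (Ioo_mem_nhdsLT h₁.2)] with t ht
      exact hle.trans (hmono t₁ h₁ t ⟨h₁.1.trans ht.1, ht.2⟩ (EReal.coe_lt_coe_iff.1 ht.1).le)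
    by_contra! hall
    obtain ⟨c, hc, hcs⟩ := hspeed ‖x t₀‖ R hr₀ (hall t₀ ht₀).le
    have hβ : β ≤ ((t₀ + R ^ 2 / c : ℝ) : EReal) := by
      by_contra! hlt
      obtain ⟨u, hu, huβ⟩ := EReal.lt_iff_exists_real_btwn.1 hlt
      rw [EReal.coe_lt_coe_iff] at hu
      have hut : t₀ ≤ u := (le_add_of_nonneg_right (by positivity)).trans hu.le
      have hus : u ∈ s := ⟨hαt₀.trans_le (EReal.coe_le_coe_iff.2 hut), huβ⟩
      have h1 := hcs t₀ ht₀ u hus hut le_rfl (hall u hus).le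
      have h2 : u - t₀ ≤ R ^ 2 / c := (le_div_iff₀' hc).2 h1
      linarith
    lift β to ℝ using ⟨(hβ.trans_lt (EReal.coe_lt_top _)).ne, (bot_le.trans_lt ht₀β).ne'⟩
    have htb : t₀ < β := EReal.coe_lt_coe_iff.1 ht₀β
    have hsub : ∀ t ∈ Ioo t₀ β, t ∈ s := fun t ht =>
      ⟨hαt₀.trans (EReal.coe_lt_coe_iff.2 ht.1), EReal.coe_lt_coe_iff.2 ht.2⟩
    obtain ⟨y, η, hη, hyx, hy⟩ := exists_extension_right hf htb
      (fun t ht => hx t (hsub t ht).1 (hsub t ht).2) hr₀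
      (fun t ht => hmono t₀ ht₀ t (hsub t ht) ht.1.le) (fun t ht => (hall t (hsub t ht)).le)
    have hlt : (β : EReal) < ((β + η : ℝ) : EReal) := EReal.coe_lt_coe_iff.2 (by linarith)
    refine hmax ⟨α, (β + η : ℝ), y, le_rfl, hlt.le, .inr hlt, fun t h1 h2 => ?_,
      fun t _ h2 => hyx t (EReal.coe_lt_coe_iff.1 h2)⟩
    rcases le_or_gt β t with hta | hta
    · exact hy t ⟨hta, EReal.coe_lt_coe_iff.1 h2⟩
    · have hta' := EReal.coe_lt_coe_iff.2 hta
      rw [hyx t hta]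
      refine ⟨hx0 t h1 hta', (hx t h1 hta').congr_of_eventuallyEq ?_⟩
      filter_upwards [Iio_mem_nhds hta] with u hu using hyx u hu
end
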